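/- arXiv:2304.14748 — 2 statements merged into one kernel-verified Lean document; each statement's English description precedes it below -/
import Mathlib

section
/- There exist absolute constants $c_1, c_2 \in \mathbb{N}$ such that for every $d \in \mathbb{N}$, every weight $\omega: \mathbb{Z}^d \to (0,\infty)$ with $\sum_{\mathbf{k} \in \mathbb{Z}^d} \omega(\mathbf{k})^{-2} < \infty$, and every $m \in \mathbb{N}$, the sampling numbers of ${\rm APP}_{\infty,d}: H^\omega(\mathbb{T}^d) \to L_\infty(\mathbb{T}^d)$ satisfy $g_{c_1 m}({\rm APP}_{\infty,d}) \leq c_2\, a_{m+1}({\rm APP}_{\infty,d}) = c_2 \Big(\sum_{k=m+1}^\infty \lambda_{k,d}\Big)^{1/2}$; equivalently, $e(c_1 m, {\rm APP}_{\infty,d}; \Lambda^{\rm std}) \leq c_2\, e(m, {\rm APP}_{\infty,d}; \Lambda^{\rm all})$. -/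
open Filter
open scoped ENNReal NNReal

noncomputable section

/-- Coefficient space: `ℓ²` sequences indexed by `ℤ^d`.  An element `u` represents the
function `f ∈ H^ω(𝕋^d)` with Fourier coefficients `f̂(k) = u k / ω k`, so that
`‖u‖_{ℓ²} = ‖f‖_{H^ω}`. -/
abbrev Coef (d : ℕ) := lp (fun _ : Fin d → ℤ => ℂ) 2

/-- The periodic function represented by the coefficients `u`:
`f(x) = ∑_{k ∈ ℤ^d} (u k / ω k) e^{2πi k·x}`. -/
def torusFn {d : ℕ} (ω : (Fin d → ℤ) → ℝ) (u : Coef d) (x : Fin d → ℝ) : ℂ :=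
  ∑' k : Fin d → ℤ,
    ((ω k : ℂ))⁻¹ * u k * Complex.exp (2 * Real.pi * Complex.I * ∑ j, (k j : ℂ) * (x j : ℂ))

/-- The torus `𝕋^d`, modelled as the cube `[0,1]^d`. -/
def cube (d : ℕ) : Set (Fin d → ℝ) := {x | ∀ j, x j ∈ Set.Icc (0 : ℝ) 1}

/-- Standard information: point-evaluation functionals `f ↦ f(x)`. -/
def stdInfo {d : ℕ} (ω : (Fin d → ℤ) → ℝ) : Set (Coef d → ℂ) :=
  {L | ∃ x ∈ cube d, L = fun u => torusFn ω u x}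

/-- General linear information: all continuous linear functionals on `H^ω`. -/
def allInfo (d : ℕ) : Set (Coef d → ℂ) := {L | ∃ T : Coef d →L[ℂ] ℂ, L = ⇑T}

/-- The `n`-th minimal worst case error `e(n, APP_{∞,d}; Λ)` of `L_∞`-approximation on the
unit ball of `H^ω(𝕋^d)`, using algorithms `f ↦ φ(L₁ f, …, Lₙ f)` with `Lᵢ ∈ Λ`. -/
def wcErr {d : ℕ} (ω : (Fin d → ℤ) → ℝ) (Λ : Set (Coef d → ℂ)) (n : ℕ) : ℝ≥0∞ :=
  ⨅ (L : Fin n → Coef d → ℂ) (_ : ∀ i, L i ∈ Λ) (φ : (Fin n → ℂ) → (Fin d → ℝ) → ℂ),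
    ⨆ (u : Coef d) (_ : ‖u‖ ≤ 1) (x : Fin d → ℝ) (_ : x ∈ cube d),
      (‖torusFn ω u x - φ (fun i => L i u) x‖₊ : ℝ≥0∞)

/-- The initial error `e(0, APP_{∞,d}) = sup_{‖f‖_{H^ω} ≤ 1} ‖f‖_∞`. -/
def initErr {d : ℕ} (ω : (Fin d → ℤ) → ℝ) : ℝ≥0∞ :=
  ⨆ (u : Coef d) (_ : ‖u‖ ≤ 1) (x : Fin d → ℝ) (_ : x ∈ cube d),
    (‖torusFn ω u x‖₊ : ℝ≥0∞)

/-- The error criterion: absolute (ABS) or normalized (NOR). -/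
inductive Crit | ABS | NOR

/-- `CRI_d`: the normalizing quantity of the error criterion. -/
def CRI {d : ℕ} (ω : (Fin d → ℤ) → ℝ) : Crit → ℝ≥0∞
  | Crit.ABS => 1
  | Crit.NOR => initErr ω

/-- The information complexity `n^⋆(ε, d; Λ)`. -/
def infoComp {d : ℕ} (ω : (Fin d → ℤ) → ℝ) (Λ : Set (Coef d → ℂ)) (crit : Crit) (ε : ℝ) : ℕ :=
  sInf {n : ℕ | wcErr ω Λ n ≤ ENNReal.ofReal ε * CRI ω crit}


def ex {d : ℕ} (k : Fin d → ℤ) (x : Fin d → ℝ) : ℂ :=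
  Complex.exp (2 * Real.pi * Complex.I * ∑ j, (k j : ℂ) * (x j : ℂ))

lemma norm_ex {d : ℕ} (k : Fin d → ℤ) (x : Fin d → ℝ) : ‖ex k x‖ = 1 := by
  have : (2 * Real.pi * Complex.I * ∑ j, (k j : ℂ) * (x j : ℂ)) =
      ((2 * Real.pi * ∑ j, (k j : ℝ) * (x j : ℝ) : ℝ) : ℂ) * Complex.I := by
    push_cast; ring
  rw [ex, this, Complex.norm_exp_ofReal_mul_I]

lemma mFourier_ex {d : ℕ} (k : Fin d → ℤ) (x : Fin d → ℝ) :
    UnitAddTorus.mFourier k (fun j => (x j : UnitAddCircle)) = ex k x := by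
  simp only [UnitAddTorus.mFourier, ContinuousMap.coe_mk, ex]
  rw [Finset.mul_sum, Complex.exp_sum]
  refine Finset.prod_congr rfl fun j _ => ?_
  rw [fourier_coe_apply]
  congr 1
  push_cast
  ring

def nu (d : ℕ) : MeasureTheory.Measure (UnitAddTorus (Fin d)) :=
  MeasureTheory.Measure.pi (fun _ : Fin d => (AddCircle.haarAddCircle : MeasureTheory.Measure UnitAddCircle))

instance (d : ℕ) : MeasureTheory.IsProbabilityMeasure (nu d) := by
  unfold nu; infer_instance

lemma integral_fourier1 (k l : ℤ) :
    ∫ t : UnitAddCircle, star (fourier k t) * fourier l t ∂AddCircle.haarAddCircle =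
      if k = l then 1 else 0 := by
  have h := orthonormal_iff_ite.mp (orthonormal_fourier (T := 1)) k l
  simp only [MeasureTheory.ContinuousMap.inner_toLp] at h
  rw [← h]
  congr 1
  ext t
  exact mul_comm _ _

lemma integral_mFourier {d : ℕ} (k l : Fin d → ℤ) :
    ∫ t, star (UnitAddTorus.mFourier k t) * UnitAddTorus.mFourier l t ∂(nu d) =
      if k = l then 1 else 0 := by
  have h1 : ∀ t : UnitAddTorus (Fin d),
      star (UnitAddTorus.mFourier k t) * UnitAddTorus.mFourier l t =
      ∏ j, (fun (j : Fin d) (s : UnitAddCircle) => star (fourier (k j) s) * fourier (l j) s) j (t j) := by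
    intro t
    simp only [UnitAddTorus.mFourier, ContinuousMap.coe_mk, Finset.prod_mul_distrib]
    rw [star_prod]
  simp only [h1]
  rw [nu]
  have := MeasureTheory.integral_fintype_prod_eq_prod (𝕜 := ℂ)
    (μ := fun _ : Fin d => (AddCircle.haarAddCircle : MeasureTheory.Measure UnitAddCircle))
    (fun (j : Fin d) (s : UnitAddCircle) => star (fourier (k j) s) * fourier (l j) s)
  refine this.trans ?_
  simp only [integral_fourier1]
  by_cases h : k = l
  · subst h; simp
  · rw [if_neg h]
    obtain ⟨i, hi⟩ := Function.ne_iff.mp h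
    exact Finset.prod_eq_zero (Finset.mem_univ i) (if_neg hi)

lemma exists_rep {d : ℕ} (t : UnitAddTorus (Fin d)) :
    ∃ x ∈ cube d, (fun j => (x j : UnitAddCircle)) = t := by
  have h : ∀ j, ∃ y : ℝ, y ∈ Set.Icc (0:ℝ) 1 ∧ (y : UnitAddCircle) = t j := by
    intro j
    refine ⟨(AddCircle.equivIco 1 0 (t j) : ℝ), ?_, ?_⟩
    · have := (AddCircle.equivIco (1:ℝ) 0 (t j)).2
      exact ⟨this.1, this.2.le.trans (by norm_num)⟩
    · exact (AddCircle.equivIco (1:ℝ) 0).symm_apply_apply (t j)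
  choose y hy using h
  exact ⟨y, fun j => (hy j).1, funext fun j => (hy j).2⟩

lemma avg {d R : ℕ} (κ : Fin R → (Fin d → ℤ)) (hκ : Function.Injective κ)
    (Q : Matrix (Fin R) (Fin R) ℂ) :
    ∃ x ∈ cube d, (Q.trace).re ≤
      (star (fun k => ex (κ k) x) ⬝ᵥ (Q.mulVec (fun k => ex (κ k) x))).re := by
  let F : UnitAddTorus (Fin d) → ℂ := fun t => ∑ k, ∑ l, Q k l *
    (star (UnitAddTorus.mFourier (κ k) t) * UnitAddTorus.mFourier (κ l) t)
  have hcont : ∀ k l, Continuous fun t => Q k l *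
    (star (UnitAddTorus.mFourier (κ k) t) * UnitAddTorus.mFourier (κ l) t) := by
    intro k l
    exact continuous_const.mul ((continuous_star.comp (UnitAddTorus.mFourier (κ k)).continuous).mul
      (UnitAddTorus.mFourier (κ l)).continuous)
  have hFc : Continuous F := continuous_finsetSum _ fun k _ => continuous_finsetSum _ fun l _ =>
    hcont k l
  have hint : ∀ G : UnitAddTorus (Fin d) → ℂ, Continuous G → MeasureTheory.Integrable G (nu d) := by
    intro G hG
    exact hG.integrable_of_hasCompactSupport (HasCompactSupport.of_compactSpace G)
  have hF : ∫ t, F t ∂(nu d) = Q.trace := by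
    simp only [F]
    rw [MeasureTheory.integral_finsetSum _ (fun k _ => hint _ (continuous_finsetSum _ fun l _ =>
      hcont k l))]
    rw [Matrix.trace]
    refine Finset.sum_congr rfl fun k _ => ?_
    rw [MeasureTheory.integral_finsetSum _ (fun l _ => hint _ (hcont k l))]
    rw [Finset.sum_eq_single k]
    · rw [MeasureTheory.integral_const_mul, integral_mFourier]; simp
    · intro l _ hl
      rw [MeasureTheory.integral_const_mul, integral_mFourier,
        if_neg (fun h => hl (hκ h).symm)]; simp
    · simp
  obtain ⟨t, ht⟩ := MeasureTheory.exists_integral_le (μ := nu d)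
    (f := fun t => (F t).re) (hint F hFc).re
  obtain ⟨x, hx, rfl⟩ := exists_rep t
  refine ⟨x, hx, ?_⟩
  have h2 : ∫ t, (F t).re ∂(nu d) = (∫ t, F t ∂(nu d)).re := integral_re (hint F hFc)
  rw [h2, hF] at ht
  refine ht.trans (le_of_eq ?_)
  congr 1
  simp only [F, mFourier_ex, dotProduct, Matrix.mulVec, Finset.mul_sum, Pi.star_apply]
  refine Finset.sum_congr rfl fun k _ => Finset.sum_congr rfl fun l _ => ?_
  ring


section
open scoped ComplexOrder

lemma bss_step {R : ℕ} (A : Matrix (Fin R) (Fin R) ℂ) (hA : A.PosDef) (p : ℝ) (hp : 0 < p)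
    (htr : (A⁻¹.trace).re ≤ p) (S : Set (Fin R → ℂ))
    (hS : ∀ Q : Matrix (Fin R) (Fin R) ℂ, ∃ v ∈ S, (Q.trace).re ≤ (star v ⬝ᵥ Q.mulVec v).re) :
    ∃ v ∈ S, (A - ((1 / (4 * p) : ℝ) : ℂ) • (1 : Matrix (Fin R) (Fin R) ℂ) +
        ((1 / p : ℝ) : ℂ) • Matrix.vecMulVec v (star v)).PosDef ∧
      ((A - ((1 / (4 * p) : ℝ) : ℂ) • (1 : Matrix (Fin R) (Fin R) ℂ) +
        ((1 / p : ℝ) : ℂ) • Matrix.vecMulVec v (star v))⁻¹.trace).re ≤ p := by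
  set δ : ℝ := 1 / (4 * p) with hδ
  have hδ0 : 0 < δ := by positivity
  set U : Matrix (Fin R) (Fin R) ℂ := (hA.1.eigenvectorUnitary : Matrix (Fin R) (Fin R) ℂ) with hU
  set μ := hA.1.eigenvalues with hμ
  have hμ0 : ∀ i, 0 < μ i := hA.eigenvalues_pos
  have hUU : star U * U = 1 := Unitary.coe_star_mul_self _
  have hUU' : U * star U = 1 := Unitary.coe_mul_star_self _
  let G : (Fin R → ℝ) → Matrix (Fin R) (Fin R) ℂ := fun f =>
    U * Matrix.diagonal (fun i => (f i : ℂ)) * star U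
  have hGmul : ∀ f g, G f * G g = G (fun i => f i * g i) := by
    intro f g
    simp only [G]
    calc _ = U * Matrix.diagonal (fun i => (f i : ℂ)) * (star U * U) *
        Matrix.diagonal (fun i => (g i : ℂ)) * star U := by simp only [mul_assoc]
      _ = _ := by
        rw [hUU, mul_one, mul_assoc U, Matrix.diagonal_mul_diagonal]
        push_cast; rfl
  have hG1 : G (fun _ => 1) = 1 := by
    simp [G, hUU']
  have hGtr : ∀ f, (G f).trace.re = ∑ i, f i := by
    intro f
    simp only [G]
    rw [Matrix.trace_mul_cycle, hUU, one_mul, Matrix.trace_diagonal, Complex.re_sum]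
    simp
  have hAG : A = G μ := by
    have := hA.1.spectral_theorem
    rw [Unitary.conjStarAlgAut_apply] at this
    exact this
  have hGinv : ∀ f : Fin R → ℝ, (∀ i, f i ≠ 0) → (G f)⁻¹ = G (fun i => (f i)⁻¹) := by
    intro f hf
    apply Matrix.inv_eq_right_inv
    rw [hGmul, ← hG1]
    congr 1
    ext i
    exact mul_inv_cancel₀ (hf i)
  have hsum : ∑ i, (μ i)⁻¹ ≤ p := by
    rw [← hGtr, ← hGinv μ (fun i => (hμ0 i).ne'), ← hAG]; exact htr
  have hμp : ∀ i, 4 * δ ≤ μ i := by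
    intro i
    have h1 : (μ i)⁻¹ ≤ p := le_trans
      (Finset.single_le_sum (f := fun i => (μ i)⁻¹) (fun j _ => (inv_pos.2 (hμ0 j)).le)
        (Finset.mem_univ i)) hsum
    have : 4 * δ = p⁻¹ := by rw [hδ]; field_simp
    rw [this]
    exact inv_le_of_inv_le₀ (hμ0 i) h1
  have hB : A - (δ : ℂ) • (1 : Matrix (Fin R) (Fin R) ℂ) = G (fun i => μ i - δ) := by
    rw [hAG, ← hG1]
    simp only [G]
    rw [← Matrix.smul_mul, ← Matrix.mul_smul, ← Matrix.sub_mul, ← Matrix.mul_sub]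
    congr 2
    ext i j
    by_cases h : i = j
    · subst h; simp
    · simp [h]
  have hν : ∀ i, 0 < μ i - δ := fun i => by linarith [hμp i]
  have hBpos : (G (fun i => μ i - δ)).PosDef := by
    have hu : IsUnit U := Unitary.isUnit_coe
    refine (Matrix.IsUnit.posDef_star_right_conjugate_iff hu).2 ?_
    refine Matrix.PosDef.diagonal fun i => ?_
    exact_mod_cast hν i
  rw [hB]
  set L := G (fun i => (μ i - δ)⁻¹) with hL
  have hLB : G (fun i => μ i - δ) * L = 1 := by
    rw [hL, ← hGinv _ (fun i => (hν i).ne')]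
    exact Matrix.mul_nonsing_inv _ ((Matrix.isUnit_iff_isUnit_det _).1 hBpos.isUnit)
  have hLpos : L.PosDef := by
    rw [hL, ← hGinv _ (fun i => (hν i).ne')]; exact hBpos.inv
  set t1 := ∑ i, (μ i - δ)⁻¹ with ht1
  set t2 := ∑ i, (μ i - δ)⁻¹ * (μ i - δ)⁻¹ with ht2
  set Δ := t1 - ∑ i, (μ i)⁻¹ with hΔ
  have hLtr : L.trace.re = t1 := hGtr _
  have hL2tr : (L * L).trace.re = t2 := by rw [hL, hGmul, hGtr]
  have ht1p : t1 ≤ 4 / 3 * p := by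
    refine le_trans ?_ (mul_le_mul_of_nonneg_left hsum (by norm_num))
    rw [Finset.mul_sum]
    refine Finset.sum_le_sum fun i _ => ?_
    rw [← div_eq_mul_inv, ← one_div, div_le_div_iff₀ (hν i) (hμ0 i)]
    linarith [hμp i]
  have hterm : ∀ i, (μ i - δ)⁻¹ - (μ i)⁻¹ = δ * ((μ i)⁻¹ * (μ i - δ)⁻¹) := by
    intro i
    have := (hν i).ne'
    have := (hμ0 i).ne'
    field_simp
    ring
  have hΔ' : Δ = ∑ i, δ * ((μ i)⁻¹ * (μ i - δ)⁻¹) := by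
    rw [hΔ, ht1, ← Finset.sum_sub_distrib]
    exact Finset.sum_congr rfl fun i _ => hterm i
  have hΔ0 : 0 ≤ Δ := by
    rw [hΔ']
    refine Finset.sum_nonneg fun i _ => ?_
    have := hν i
    have := hμ0 i
    positivity
  have hΔ2 : Δ ≤ δ * t2 := by
    rw [hΔ', ht2, Finset.mul_sum]
    refine Finset.sum_le_sum fun i _ => ?_
    have h1 := hν i
    have : (μ i)⁻¹ ≤ (μ i - δ)⁻¹ := inv_anti₀ h1 (by linarith)
    gcongr
  have ht2' : 4 * p * Δ ≤ t2 := by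
    have : 4 * p * Δ ≤ 4 * p * (δ * t2) := by gcongr
    have h2 : 4 * p * (δ * t2) = t2 := by rw [hδ]; field_simp
    linarith
  obtain ⟨v, hvS, hv⟩ := hS (L * L - (Δ : ℂ) • L)
  refine ⟨v, hvS, ?_⟩
  set w := L.mulVec v with hw
  set q : ℝ := (star v ⬝ᵥ w).re with hq
  have hq0 : 0 ≤ q := by
    have := hLpos.posSemidef.dotProduct_mulVec_nonneg v
    exact (Complex.le_def.1 this).1
  have hqc : star v ⬝ᵥ w = (q : ℂ) := by
    have := hLpos.posSemidef.dotProduct_mulVec_nonneg v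
    apply Complex.ext
    · rfl
    · exact (Complex.le_def.1 this).2.symm
  have hstarw : star w = Matrix.vecMul (star v) L := by
    rw [hw, Matrix.star_mulVec, hLpos.1]
  set r : ℝ := (star w ⬝ᵥ w).re with hr
  have hqr : Δ * q + t2 - Δ * t1 ≤ r := by
    have e1 : (star v ⬝ᵥ (L * L - (Δ : ℂ) • L).mulVec v).re = r - Δ * q := by
      rw [Matrix.sub_mulVec, dotProduct_sub, Matrix.smul_mulVec, dotProduct_smul,
        ← Matrix.mulVec_mulVec, Matrix.dotProduct_mulVec, ← hstarw]
      simp [hr, hq, hw]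
    have e2 : ((L * L - (Δ : ℂ) • L).trace).re = t2 - Δ * t1 := by
      rw [Matrix.trace_sub, Matrix.trace_smul, Complex.sub_re, hL2tr]
      simp [hLtr]
    rw [e1, e2] at hv
    linarith
  have hkey : Δ * (q + p) ≤ r := by
    have : Δ * t1 ≤ Δ * (4 / 3 * p) := by gcongr
    have : 0 ≤ p * Δ := by positivity
    nlinarith
  have hden : (1 + (1 / p) * q) ≠ 0 := by positivity
  have hinv : (G (fun i => μ i - δ) + ((1 / p : ℝ) : ℂ) • Matrix.vecMulVec v (star v))⁻¹ =
      L - (((1 / p) / (1 + (1 / p) * q) : ℝ) : ℂ) • Matrix.vecMulVec w (star w) := by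
    apply Matrix.inv_eq_right_inv
    have hBw : (G (fun i => μ i - δ)).mulVec w = v := by
      rw [hw, Matrix.mulVec_mulVec, hLB, Matrix.one_mulVec]
    rw [Matrix.mul_sub, Matrix.add_mul, Matrix.add_mul, hLB, Matrix.smul_mul, Matrix.mul_smul,
      Matrix.mul_smul, Matrix.smul_mul, Matrix.mul_vecMulVec, hBw, Matrix.vecMulVec_mul_vecMulVec,
      Matrix.vecMulVec_mul, ← hstarw, hqc]
    rw [Matrix.vecMulVec_smul, add_sub_assoc]
    conv_rhs => rw [← add_zero (1 : Matrix (Fin R) (Fin R) ℂ)]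
    congr 1
    simp only [smul_smul]
    rw [← add_smul, ← sub_smul]
    have : (((1 / p : ℝ) : ℂ) - ((((1 / p) / (1 + (1 / p) * q) : ℝ) : ℂ) +
        (((1 / p) / (1 + (1 / p) * q) : ℝ) : ℂ) * (((1 / p : ℝ) : ℂ) * (q : ℂ)))) = 0 := by
      have : (1 / p) - ((1 / p) / (1 + (1 / p) * q) + (1 / p) / (1 + (1 / p) * q) * ((1 / p) * q))
        = 0 := by
        field_simp
        ring
      exact_mod_cast this
    rw [this, zero_smul]
  constructor
  · refine hBpos.add_posSemidef ?_
    refine (Matrix.posSemidef_vecMulVec_self_star v).smul ?_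
    exact_mod_cast (by positivity : (0:ℝ) ≤ 1 / p)
  · rw [hinv, Matrix.trace_sub, Matrix.trace_smul, Matrix.trace_vecMulVec, Complex.sub_re, hLtr,
      smul_eq_mul, Complex.re_ofReal_mul, dotProduct_comm, ← hr]
    have : Δ ≤ (1 / p) / (1 + (1 / p) * q) * r := by
      have h1 : Δ = (1 / p) / (1 + (1 / p) * q) * (Δ * (q + p)) := by
        field_simp
        ring
      rw [h1]
      gcongr
    linarith

end


section
open scoped ComplexOrder

lemma bss_iter {R : ℕ} (a : Fin R → ℝ) (ha : ∀ k, 0 < a k) (p : ℝ) (hp : 0 < p)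
    (hsum : ∑ k, (a k + 1)⁻¹ ≤ p) (S : Set (Fin R → ℂ))
    (hS : ∀ Q : Matrix (Fin R) (Fin R) ℂ, ∃ v ∈ S, (Q.trace).re ≤ (star v ⬝ᵥ Q.mulVec v).re)
    (n : ℕ) :
    ∃ V : Fin n → (Fin R → ℂ), (∀ i, V i ∈ S) ∧
      (Matrix.diagonal (fun k => ((a k + 1 : ℝ) : ℂ)) -
        (((n : ℝ) * (1 / (4 * p)) : ℝ) : ℂ) • (1 : Matrix (Fin R) (Fin R) ℂ) +
        ((1 / p : ℝ) : ℂ) • ∑ i, Matrix.vecMulVec (V i) (star (V i))).PosDef ∧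
      ((Matrix.diagonal (fun k => ((a k + 1 : ℝ) : ℂ)) -
        (((n : ℝ) * (1 / (4 * p)) : ℝ) : ℂ) • (1 : Matrix (Fin R) (Fin R) ℂ) +
        ((1 / p : ℝ) : ℂ) • ∑ i, Matrix.vecMulVec (V i) (star (V i)))⁻¹.trace).re ≤ p := by
  induction n with
  | zero =>
    refine ⟨Fin.elim0, fun i => i.elim0, ?_, ?_⟩
    · simp only [Nat.cast_zero, zero_mul, Complex.ofReal_zero, zero_smul, sub_zero,
        Finset.univ_eq_empty, Finset.sum_empty, smul_zero, add_zero]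
      refine Matrix.PosDef.diagonal fun i => ?_
      have := ha i
      exact_mod_cast (by linarith : 0 < a i + 1)
    · simp only [Nat.cast_zero, zero_mul, Complex.ofReal_zero, zero_smul, sub_zero,
        Finset.univ_eq_empty, Finset.sum_empty, smul_zero, add_zero]
      have : (Matrix.diagonal (fun k => ((a k + 1 : ℝ) : ℂ)))⁻¹ =
          Matrix.diagonal (fun k => (((a k + 1)⁻¹ : ℝ) : ℂ)) := by
        apply Matrix.inv_eq_right_inv
        rw [Matrix.diagonal_mul_diagonal, ← Matrix.diagonal_one]
        congr 1
        ext i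
        have := ha i
        rw [← Complex.ofReal_mul, mul_inv_cancel₀ (by linarith), Complex.ofReal_one]
      rw [this, Matrix.trace_diagonal, Complex.re_sum]
      simp only [Complex.ofReal_re]
      exact hsum
  | succ n ih =>
    obtain ⟨V, hV, h1, h2⟩ := ih
    obtain ⟨v, hv, h3, h4⟩ := bss_step _ h1 p hp h2 S hS
    have hE : (Matrix.diagonal (fun k => ((a k + 1 : ℝ) : ℂ)) -
        ((((n + 1 : ℕ) : ℝ) * (1 / (4 * p)) : ℝ) : ℂ) • (1 : Matrix (Fin R) (Fin R) ℂ) +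
        ((1 / p : ℝ) : ℂ) • ∑ i, Matrix.vecMulVec ((Fin.snoc V v : Fin (n+1) → (Fin R → ℂ)) i)
          (star ((Fin.snoc V v : Fin (n+1) → (Fin R → ℂ)) i))) =
        (Matrix.diagonal (fun k => ((a k + 1 : ℝ) : ℂ)) -
        (((n : ℝ) * (1 / (4 * p)) : ℝ) : ℂ) • (1 : Matrix (Fin R) (Fin R) ℂ) +
        ((1 / p : ℝ) : ℂ) • ∑ i, Matrix.vecMulVec (V i) (star (V i))) -
        ((1 / (4 * p) : ℝ) : ℂ) • (1 : Matrix (Fin R) (Fin R) ℂ) +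
        ((1 / p : ℝ) : ℂ) • Matrix.vecMulVec v (star v) := by
      rw [Fin.sum_univ_castSucc]
      simp only [Fin.snoc_castSucc, Fin.snoc_last]
      push_cast
      rw [smul_add, add_mul, add_smul, one_mul]
      abel
    refine ⟨Fin.snoc V v, ?_, ?_, ?_⟩
    · intro i
      refine Fin.lastCases ?_ (fun i => ?_) i
      · simpa using hv
      · simpa using hV i
    · rw [hE]; exact h3
    · rw [hE]; exact h4

lemma bss_coef {R : ℕ} (a : Fin R → ℝ) (ha : ∀ k, 0 < a k) (p : ℝ) (hp : 0 < p)
    (hsum : ∑ k, (a k + 1)⁻¹ ≤ p) (S : Set (Fin R → ℂ))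
    (hS : ∀ Q : Matrix (Fin R) (Fin R) ℂ, ∃ v ∈ S, (Q.trace).re ≤ (star v ⬝ᵥ Q.mulVec v).re)
    (n : ℕ) (hn : (n : ℝ) = 8 * p) :
    ∃ V : Fin n → (Fin R → ℂ), (∀ i, V i ∈ S) ∧
      ∀ v : Fin R → ℂ, (∀ k, ‖v k‖ = 1) → ∃ c : Fin n → ℂ,
        ∑ k, ‖v k - ∑ i, c i * V i k‖ ^ 2 / a k ≤ 2 * p ∧ ∑ i, ‖c i‖ ^ 2 ≤ 2 := by
  obtain ⟨V, hV, hpd, -⟩ := bss_iter a ha p hp hsum S hS n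
  refine ⟨V, hV, fun v hv => ?_⟩
  have hn2 : (n : ℝ) * (1 / (4 * p)) = 2 := by rw [hn]; field_simp; norm_num
  rw [hn2] at hpd
  set A := (Matrix.diagonal (fun k => ((a k + 1 : ℝ) : ℂ)) -
        ((2 : ℝ) : ℂ) • (1 : Matrix (Fin R) (Fin R) ℂ) +
        ((1 / p : ℝ) : ℂ) • ∑ i, Matrix.vecMulVec (V i) (star (V i))) with hA
  have hM : (A + 1).PosDef := hpd.add Matrix.PosDef.one
  set y := (A + 1)⁻¹.mulVec v with hy
  have hMy : (A + 1).mulVec y = v := by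
    rw [hy, Matrix.mulVec_mulVec, Matrix.mul_nonsing_inv _
      ((Matrix.isUnit_iff_isUnit_det _).1 hM.isUnit), Matrix.one_mulVec]
  set b : Fin n → ℂ := fun i => star (V i) ⬝ᵥ y with hb
  have hMy' : ∀ k, v k = a k * y k + (1 / p : ℝ) * ∑ i, b i * V i k := by
    intro k
    have h0 : A + 1 = Matrix.diagonal (fun k => ((a k : ℝ) : ℂ)) +
        ((1 / p : ℝ) : ℂ) • ∑ i, Matrix.vecMulVec (V i) (star (V i)) := by
      have : Matrix.diagonal (fun k => ((a k + 1 : ℝ) : ℂ)) =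
          Matrix.diagonal (fun k => ((a k : ℝ) : ℂ)) + 1 := by
        rw [← Matrix.diagonal_one, Matrix.diagonal_add]
        congr 1; ext i; push_cast; rfl
      rw [hA, this]
      have h2 : (((2:ℝ) : ℂ)) • (1 : Matrix (Fin R) (Fin R) ℂ) = 1 + 1 := by
        push_cast; rw [two_smul]
      rw [h2]
      abel
    conv_lhs => rw [← hMy, h0]
    rw [Matrix.add_mulVec, Matrix.smul_mulVec, Matrix.sum_mulVec]
    simp only [Pi.add_apply, Matrix.mulVec_diagonal, Pi.smul_apply, Finset.sum_apply, smul_eq_mul,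
      Matrix.vecMulVec_mulVec, hb]
    congr 2
    refine Finset.sum_congr rfl fun i _ => ?_
    simp [mul_comm]
  set E1 := ∑ k, a k * ‖y k‖ ^ 2 with hE1
  set E2 := (1 / p) * ∑ i, ‖b i‖ ^ 2 with hE2
  have hE10 : 0 ≤ E1 := Finset.sum_nonneg fun k _ => mul_nonneg (ha k).le (by positivity)
  have hE20 : 0 ≤ E2 := by positivity
  have hyv : star y ⬝ᵥ v = ((E1 + E2 : ℝ) : ℂ) := by
    have h1 : ∀ i, ∑ k, star (y k) * V i k = star (b i) := by
      intro i
      simp only [hb, dotProduct, star_sum, star_mul', Pi.star_apply, star_star]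
      refine Finset.sum_congr rfl fun k _ => ?_
      ring
    calc star y ⬝ᵥ v = ∑ k, (a k * (star (y k) * y k) +
          (1 / p : ℝ) * ∑ i, b i * (star (y k) * V i k)) := by
          simp only [dotProduct, Pi.star_apply]
          refine Finset.sum_congr rfl fun k _ => ?_
          conv_lhs => rw [hMy' k]
          rw [mul_add, Finset.mul_sum, Finset.mul_sum, Finset.mul_sum]
          congr 1
          · ring
          · refine Finset.sum_congr rfl fun i _ => ?_
            ring
      _ = ∑ k, a k * (star (y k) * y k) + (1 / p : ℝ) * ∑ i, b i * star (b i) := by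
          rw [Finset.sum_add_distrib, ← Finset.mul_sum, Finset.sum_comm]
          congr 2
          refine Finset.sum_congr rfl fun i _ => ?_
          rw [← Finset.mul_sum, h1]
      _ = _ := by
          rw [hE1, hE2]
          push_cast
          congr 1
          · refine Finset.sum_congr rfl fun k _ => ?_
            rw [← Complex.conj_mul']; rfl
          · congr 1
            refine Finset.sum_congr rfl fun k _ => ?_
            rw [← Complex.mul_conj']; rfl
  have hq : ∑ k, ‖y k‖ ^ 2 ≤ E1 + E2 := by
    have h1 := hpd.posSemidef.dotProduct_mulVec_nonneg y
    have h2 : A.mulVec y = v - y := by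
      have h5 := hMy
      rw [Matrix.add_mulVec A 1, Matrix.one_mulVec] at h5
      exact eq_sub_of_add_eq h5
    rw [h2, dotProduct_sub, hyv] at h1
    have h3 : star y ⬝ᵥ y = ((∑ k, ‖y k‖ ^ 2 : ℝ) : ℂ) := by
      simp only [dotProduct, Pi.star_apply]
      push_cast
      refine Finset.sum_congr rfl fun k _ => ?_
      rw [← Complex.conj_mul']; rfl
    rw [h3, ← Complex.ofReal_sub] at h1
    have := Complex.zero_le_real.1 h1
    linarith
  set q := E1 + E2 with hqdef
  have hq0 : 0 ≤ q := by positivity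
  have hCS : q ^ 2 ≤ p * (2 * q) := by
    have h1 : q ≤ ∑ k, ‖y k‖ := by
      have : ‖star y ⬝ᵥ v‖ = q := by rw [hyv, Complex.norm_real, Real.norm_of_nonneg hq0]
      rw [← this]
      refine (norm_sum_le _ _).trans (le_of_eq ?_)
      refine Finset.sum_congr rfl fun k _ => ?_
      rw [norm_mul, hv, mul_one, Pi.star_apply, norm_star]
    have h2 : (∑ k, ‖y k‖) ^ 2 ≤ (∑ k, (a k + 1)⁻¹) * ∑ k, (a k + 1) * ‖y k‖ ^ 2 := by
      refine Finset.sum_sq_le_sum_mul_sum_of_sq_le_mul _ (fun k _ => ?_) (fun k _ => ?_)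
        (fun k _ => ?_)
      · have := ha k; positivity
      · have := ha k; positivity
      · have := ha k; apply le_of_eq; field_simp
    have h3 : ∑ k, (a k + 1) * ‖y k‖ ^ 2 = E1 + ∑ k, ‖y k‖ ^ 2 := by
      rw [hE1, ← Finset.sum_add_distrib]
      refine Finset.sum_congr rfl fun k _ => ?_
      ring
    calc q ^ 2 ≤ (∑ k, ‖y k‖) ^ 2 := by gcongr
      _ ≤ _ := h2
      _ ≤ p * (2 * q) := by
        rw [h3]
        have : 0 ≤ ∑ k, ‖y k‖ ^ 2 := by positivity
        gcongr
        linarith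
  have hq2 : q ≤ 2 * p := by
    rcases hq0.eq_or_lt with h | h
    · rw [← h]; positivity
    · nlinarith
  refine ⟨fun i => (1 / p : ℝ) * b i, ?_, ?_⟩
  · refine le_trans (le_of_eq ?_) ((by linarith : E1 ≤ q).trans hq2)
    rw [hE1]
    refine Finset.sum_congr rfl fun k _ => ?_
    have : v k - ∑ i, (1 / p : ℝ) * b i * V i k = a k * y k := by
      conv_lhs => rw [hMy' k]
      rw [Finset.mul_sum]
      simp only [mul_assoc]
      ring
    rw [this, norm_mul, Complex.norm_real, Real.norm_of_nonneg (ha k).le]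
    have := (ha k).ne'
    field_simp
  · have : ∑ i, ‖((1 / p : ℝ) : ℂ) * b i‖ ^ 2 = (1 / p) * E2 := by
      rw [hE2, Finset.mul_sum, Finset.mul_sum]
      refine Finset.sum_congr rfl fun i _ => ?_
      rw [norm_mul, Complex.norm_real, Real.norm_of_nonneg (by positivity)]
      ring
    rw [this]
    have h5 : E2 ≤ 2 * p := by linarith
    calc (1 / p) * E2 ≤ (1 / p) * (2 * p) := by gcongr
      _ = 2 := by field_simp
end


lemma torusFn_eq {d : ℕ} (ω : (Fin d → ℤ) → ℝ) (u : Coef d) (x : Fin d → ℝ) :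
    torusFn ω u x = ∑' k, ((ω k : ℂ))⁻¹ * u k * ex k x := rfl

lemma coef_hasSum {d : ℕ} (u : Coef d) : HasSum (fun k => ‖u k‖ ^ 2) (‖u‖ ^ 2) := by
  have := lp.hasSum_norm (p := 2) (by simp) u
  simpa using this

lemma cs_bound {d : ℕ} (ω : (Fin d → ℤ) → ℝ) (hω : ∀ k, 0 < ω k) (u : Coef d)
    (r : (Fin d → ℤ) → ℂ) (hr : Summable fun k => ((ω k) ^ 2)⁻¹ * ‖r k‖ ^ 2) :
    (Summable fun k => ((ω k : ℂ))⁻¹ * u k * r k) ∧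
    ‖∑' k, ((ω k : ℂ))⁻¹ * u k * r k‖ ≤
      ‖u‖ * Real.sqrt (∑' k, ((ω k) ^ 2)⁻¹ * ‖r k‖ ^ 2) := by
  have e : ∀ k, ((ω k)⁻¹ * ‖r k‖) ^ 2 = ((ω k) ^ 2)⁻¹ * ‖r k‖ ^ 2 := by
    intro k; rw [mul_pow, inv_pow]
  have h := Real.summable_and_inner_le_Lp_mul_Lq_tsum_of_nonneg (p := 2) (q := 2)
    (f := fun k => ‖u k‖) (g := fun k => (ω k)⁻¹ * ‖r k‖) Real.HolderConjugate.two_two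
    (fun k => norm_nonneg _) (fun k => mul_nonneg (inv_pos.2 (hω k)).le (norm_nonneg _))
    (by simpa using (coef_hasSum u).summable) (by simpa [e] using hr)
  have hn : ∀ k, ‖((ω k : ℂ))⁻¹ * u k * r k‖ = ‖u k‖ * ((ω k)⁻¹ * ‖r k‖) := by
    intro k
    rw [norm_mul, norm_mul, norm_inv, Complex.norm_real, Real.norm_of_nonneg (hω k).le]
    ring
  have hs : Summable fun k => ‖((ω k : ℂ))⁻¹ * u k * r k‖ := by
    simp only [hn]; exact h.1
  refine ⟨hs.of_norm, (norm_tsum_le_tsum_norm hs).trans ?_⟩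
  simp only [hn]
  refine h.2.trans (le_of_eq ?_)
  have e2 : ∀ z : ℝ, z ^ (2:ℝ) = z ^ 2 := fun z => by norm_cast
  simp only [e2, e]
  rw [(coef_hasSum u).tsum_eq, ← Real.sqrt_eq_rpow, ← Real.sqrt_eq_rpow,
    Real.sqrt_sq (norm_nonneg _)]

lemma ofReal_err {B : ℝ} (z : ℂ) (h : ‖z‖ ≤ B) : (‖z‖₊ : ℝ≥0∞) ≤ ENNReal.ofReal B := by
  have h1 : ENNReal.ofReal ‖z‖ = (‖z‖₊ : ℝ≥0∞) := ofReal_norm z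
  rw [← h1]
  exact ENNReal.ofReal_le_ofReal h


lemma lam_summable {d : ℕ} {ω : (Fin d → ℤ) → ℝ} (hs : Summable fun k => ((ω k) ^ 2)⁻¹)
    {lam : ℕ → ℝ} {σ : ℕ ≃ (Fin d → ℤ)} (hσ : ∀ k, lam k = ((ω (σ k)) ^ 2)⁻¹) :
    Summable lam := by
  have : lam = (fun k => ((ω k) ^ 2)⁻¹) ∘ σ := funext hσ
  rw [this]
  exact (Equiv.summable_iff σ).2 hs

lemma sum_le_2m (lam : ℕ → ℝ) (hl : ∀ k, 0 < lam k) (hs : Summable lam) (m R : ℕ) (hm : 0 < m)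
    (T : ℝ) (hT : T = ∑' j, lam (m + j)) (hT0 : 0 < T) :
    ∑ k : Fin R, (T / (m * lam k) + 1)⁻¹ ≤ 2 * m := by
  have hm' : (0:ℝ) < m := by exact_mod_cast hm
  have h0 : ∀ k, 0 ≤ (T / (m * lam k) + 1)⁻¹ := fun k => by
    have := hl k; positivity
  rw [Fin.sum_univ_eq_sum_range (fun k => (T / (m * lam k) + 1)⁻¹)]
  have h1 : ∑ k ∈ Finset.range R, (T / (m * lam k) + 1)⁻¹ ≤
      ∑ k ∈ Finset.range (m + R), (T / (m * lam k) + 1)⁻¹ :=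
    Finset.sum_le_sum_of_subset_of_nonneg (Finset.range_mono (by omega)) fun k _ _ => h0 k
  refine h1.trans ?_
  rw [Finset.sum_range_add]
  have h2 : ∑ k ∈ Finset.range m, (T / (m * lam k) + 1)⁻¹ ≤ m := by
    calc _ ≤ ∑ k ∈ Finset.range m, (1:ℝ) := by
          refine Finset.sum_le_sum fun k _ => ?_
          have := hl k
          apply inv_le_one_of_one_le₀
          have : 0 ≤ T / (m * lam k) := by positivity
          linarith
      _ = m := by simp
  have h3 : ∑ k ∈ Finset.range R, (T / (m * lam (m + k)) + 1)⁻¹ ≤ m := by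
    calc _ ≤ ∑ k ∈ Finset.range R, (m / T) * lam (m + k) := by
          refine Finset.sum_le_sum fun k _ => ?_
          have := hl (m + k)
          have e : (m / T) * lam (m + k) = (T / (m * lam (m + k)))⁻¹ := by
            field_simp
          rw [e]
          apply inv_anti₀ (by positivity)
          linarith
      _ = (m / T) * ∑ k ∈ Finset.range R, lam (m + k) := by rw [Finset.mul_sum]
      _ ≤ (m / T) * T := by
          gcongr
          rw [hT]
          refine Summable.sum_le_tsum _ (fun k _ => (hl _).le) ?_
          exact hs.comp_injective (add_right_injective m)
      _ = m := by field_simp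
  linarith

lemma std_bound {d : ℕ} (ω : (Fin d → ℤ) → ℝ) (hω : ∀ k, 0 < ω k)
    (hs : Summable fun k => ((ω k) ^ 2)⁻¹) (lam : ℕ → ℝ) (σ : ℕ ≃ (Fin d → ℤ))
    (hσ : ∀ k, lam k = ((ω (σ k)) ^ 2)⁻¹) (m : ℕ) (hm : 0 < m) :
    wcErr ω (stdInfo ω) (16 * m) ≤ ENNReal.ofReal (3 * Real.sqrt (∑' j, lam (m + j))) := by
  have hl : ∀ k, 0 < lam k := fun k => by rw [hσ]; have := hω (σ k); positivity
  have hsl : Summable lam := lam_summable hs hσ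
  have hm' : (0:ℝ) < m := by exact_mod_cast hm
  obtain ⟨T, hT⟩ : ∃ T, T = ∑' j, lam (m + j) := ⟨_, rfl⟩
  have hT0 : 0 < T := by
    rw [hT]
    exact (hsl.comp_injective (add_right_injective m)).tsum_pos (fun j => (hl _).le) 0 (hl _)
  rw [← hT]
  obtain ⟨R, hR⟩ : ∃ R, ∑' j, lam (j + R) < T / (2 + 64 * m) := by
    have h := tendsto_sum_nat_add lam
    have h2 : (0:ℝ) < T / (2 + 64 * m) := by positivity
    exact (h.eventually (gt_mem_nhds h2)).exists
  let κ : Fin R → (Fin d → ℤ) := fun k => σ k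
  have hκ : Function.Injective κ := σ.injective.comp Fin.val_injective
  obtain ⟨V, hV, hc⟩ := bss_coef (fun k : Fin R => T / (m * lam k))
    (fun k => by have := hl k; positivity) (2 * m) (by positivity)
    (sum_le_2m lam hl hsl m R hm T hT hT0)
    {v | ∃ x ∈ cube d, v = fun k => ex (κ k) x}
    (fun Q => by
      obtain ⟨x, hx, h⟩ := avg κ hκ Q
      exact ⟨_, ⟨x, hx, rfl⟩, h⟩) (16 * m) (by push_cast; ring)
  choose X hX hVX using hV
  choose c hc1 hc2 using fun x : Fin d → ℝ => hc (fun k => ex (κ k) x) (fun k => norm_ex _ _)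
  unfold wcErr
  refine iInf_le_of_le (fun i u => torusFn ω u (X i)) (iInf_le_of_le (fun i => ⟨X i, hX i, rfl⟩)
    (iInf_le_of_le (fun z x => ∑ i, c x i * z i) ?_))
  refine iSup_le fun u => iSup_le fun hu => iSup_le fun x => iSup_le fun hx => ofReal_err _ ?_
  have hsum1 : ∀ x, Summable fun k => ((ω k : ℂ))⁻¹ * u k * ex k x := fun x =>
    (cs_bound ω hω u (fun k => ex k x) (by simpa [norm_ex] using hs)).1
  let r : (Fin d → ℤ) → ℂ := fun k => ex k x - ∑ i, c x i * ex k (X i)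
  have hE : torusFn ω u x - ∑ i, c x i * torusFn ω u (X i) =
      ∑' k, ((ω k : ℂ))⁻¹ * u k * r k := by
    simp only [torusFn_eq]
    simp only [← tsum_mul_left]
    rw [← Summable.tsum_finsetSum (fun i _ => (hsum1 (X i)).mul_left _),
      ← (hsum1 x).tsum_sub (summable_sum fun i _ => (hsum1 (X i)).mul_left _)]
    congr 1
    ext k
    simp only [r, mul_sub, Finset.mul_sum]
    congr 1
    refine Finset.sum_congr rfl fun i _ => ?_
    ring
  have hrb : ∀ k, ‖r k‖ ^ 2 ≤ 2 + 64 * m := by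
    intro k
    have h1 : ‖r k‖ ≤ 1 + ∑ i, ‖c x i‖ := by
      refine (norm_sub_le _ _).trans ?_
      rw [norm_ex]
      gcongr
      refine (norm_sum_le _ _).trans (le_of_eq ?_)
      refine Finset.sum_congr rfl fun i _ => ?_
      rw [norm_mul, norm_ex, mul_one]
    have h2 : (∑ i, ‖c x i‖) ^ 2 ≤ (16 * m) * 2 := by
      have := sq_sum_le_card_mul_sum_sq (s := Finset.univ) (f := fun i => ‖c x i‖)
      refine this.trans ?_
      rw [Finset.card_univ, Fintype.card_fin]
      push_cast
      have := hc2 x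
      gcongr
    have h3 : ‖r k‖ ^ 2 ≤ (1 + ∑ i, ‖c x i‖) ^ 2 := by gcongr
    nlinarith [sq_nonneg (1 - ∑ i, ‖c x i‖)]
  have hsr : Summable fun k => ((ω k) ^ 2)⁻¹ * ‖r k‖ ^ 2 := by
    refine Summable.of_nonneg_of_le (fun k => by have := hω k; positivity) (fun k => ?_)
      (hs.mul_right (2 + 64 * (m:ℝ)))
    have := hω k
    gcongr
    exact hrb k
  have hcs := (cs_bound ω hω u r hsr).2
  rw [hE]
  have hbound : ∑' k, ((ω k) ^ 2)⁻¹ * ‖r k‖ ^ 2 ≤ 9 * T := by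
    rw [← Equiv.tsum_eq σ]
    simp only [← hσ]
    have hsr' : Summable fun j => lam j * ‖r (σ j)‖ ^ 2 := by
      have := (Equiv.summable_iff σ).2 hsr
      refine this.congr fun j => ?_
      simp [hσ]
    rw [← hsr'.sum_add_tsum_nat_add R]
    have h1 : ∑ j ∈ Finset.range R, lam j * ‖r (σ j)‖ ^ 2 ≤ 4 * T := by
      have h := hc1 x
      rw [← Fin.sum_univ_eq_sum_range (fun j => lam j * ‖r (σ j)‖ ^ 2)]
      have e : ∑ k : Fin R, lam k * ‖r (σ k)‖ ^ 2 = (T / m) *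
          ∑ k : Fin R, ‖ex (κ k) x - ∑ i, c x i * V i k‖ ^ 2 / (T / (m * lam k)) := by
        rw [Finset.mul_sum]
        refine Finset.sum_congr rfl fun k _ => ?_
        have e2 : ex (κ k) x - ∑ i, c x i * V i k = r (σ k) := by
          simp only [r, hVX, κ]
        rw [e2]
        have := hl k
        field_simp
      rw [e]
      calc _ ≤ (T / m) * (2 * (2 * m)) := by gcongr
        _ = 4 * T := by field_simp; ring
    have h2 : ∑' j, lam (j + R) * ‖r (σ (j + R))‖ ^ 2 ≤ T := by
      have hsR : Summable fun j => lam (j + R) := (summable_nat_add_iff R).2 hsl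
      calc _ ≤ ∑' j, lam (j + R) * (2 + 64 * m) := by
            refine Summable.tsum_le_tsum (fun j => ?_) ((summable_nat_add_iff R).2 hsr')
              (hsR.mul_right _)
            have := hl (j + R)
            gcongr
            exact hrb _
        _ = (∑' j, lam (j + R)) * (2 + 64 * m) := tsum_mul_right
        _ ≤ T / (2 + 64 * m) * (2 + 64 * m) := by gcongr
        _ = T := by field_simp
    linarith
  calc _ ≤ ‖u‖ * Real.sqrt (∑' k, ((ω k) ^ 2)⁻¹ * ‖r k‖ ^ 2) := hcs
    _ ≤ 1 * Real.sqrt (9 * T) := by gcongr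
    _ = 3 * Real.sqrt T := by
      rw [one_mul, Real.sqrt_mul (by norm_num), show (9:ℝ) = 3 ^ 2 by norm_num,
        Real.sqrt_sq (by norm_num)]


def evC {d : ℕ} (k : Fin d → ℤ) : Coef d →L[ℂ] ℂ :=
  LinearMap.mkContinuous
    { toFun := fun u => u k
      map_add' := fun _ _ => rfl
      map_smul' := fun _ _ => rfl } 1
    (fun u => by
      rw [one_mul]; exact lp.norm_apply_le_norm (by norm_num) u k)

lemma evC_apply {d : ℕ} (k : Fin d → ℤ) (u : Coef d) : evC k u = u k := rfl

lemma tsum_split {ι E : Type*} [NormedAddCommGroup E] (σ : ℕ ≃ ι) (f : ι → E)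
    (hf : Summable f) (m : ℕ) :
    ∑' k, f k = ∑ i : Fin m, f (σ i) + ∑' j, f (σ (j + m)) := by
  have h : Summable (f ∘ σ) := (Equiv.summable_iff σ).2 hf
  rw [← Equiv.tsum_eq σ f, Fin.sum_univ_eq_sum_range (fun j => f (σ j))]
  exact (h.sum_add_tsum_nat_add m).symm

lemma all_upper {d : ℕ} (ω : (Fin d → ℤ) → ℝ) (hω : ∀ k, 0 < ω k)
    (hs : Summable fun k => ((ω k) ^ 2)⁻¹) (lam : ℕ → ℝ) (σ : ℕ ≃ (Fin d → ℤ))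
    (hσ : ∀ k, lam k = ((ω (σ k)) ^ 2)⁻¹) (m : ℕ) :
    wcErr ω (allInfo d) m ≤ ENNReal.ofReal (Real.sqrt (∑' j, lam (m + j))) := by
  have hsl : Summable lam := lam_summable hs hσ
  unfold wcErr
  refine iInf_le_of_le (fun i => ⇑(evC (σ i))) (iInf_le_of_le (fun i => ⟨_, rfl⟩)
    (iInf_le_of_le (fun z x => ∑ i : Fin m, ((ω (σ i) : ℂ))⁻¹ * z i * ex (σ i) x) ?_))
  refine iSup_le fun u => iSup_le fun hu => iSup_le fun x => iSup_le fun hx => ofReal_err _ ?_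
  have hsum1 : Summable fun k => ((ω k : ℂ))⁻¹ * u k * ex k x :=
    (cs_bound ω hω u (fun k => ex k x) (by simpa [norm_ex] using hs)).1
  let r : (Fin d → ℤ) → ℂ := fun k => if σ.symm k < m then 0 else ex k x
  have hsr : Summable fun k => ((ω k) ^ 2)⁻¹ * ‖r k‖ ^ 2 := by
    refine Summable.of_nonneg_of_le (fun k => by have := hω k; positivity) (fun k => ?_) hs
    have := hω k
    by_cases h : σ.symm k < m
    · simp only [r, h, if_true, norm_zero]; rw [zero_pow two_ne_zero, mul_zero]; positivity
    · simp [r, h, norm_ex]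
  obtain ⟨hs2, hcs⟩ := cs_bound ω hω u r hsr
  have hE : torusFn ω u x - ∑ i : Fin m, ((ω (σ i) : ℂ))⁻¹ * (evC (σ i) u) * ex (σ i) x =
      ∑' k, ((ω k : ℂ))⁻¹ * u k * r k := by
    simp only [evC_apply]
    rw [torusFn_eq, tsum_split σ _ hsum1 m, tsum_split σ _ hs2 m]
    have h0 : ∑ j : Fin m, ((ω (σ j) : ℂ))⁻¹ * u (σ j) * r (σ j) = 0 := by
      refine Finset.sum_eq_zero fun j hj => ?_
      simp [r]
    rw [h0, zero_add]
    have h1 : ∀ j, r (σ (j + m)) = ex (σ (j + m)) x := by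
      intro j; simp [r]
    simp only [h1]
    exact add_sub_cancel_left _ _
  rw [hE]
  have hb : ∑' k, ((ω k) ^ 2)⁻¹ * ‖r k‖ ^ 2 = ∑' j, lam (m + j) := by
    rw [tsum_split σ _ hsr m]
    have h0 : ∑ j : Fin m, ((ω (σ j)) ^ 2)⁻¹ * ‖r (σ j)‖ ^ 2 = 0 := by
      refine Finset.sum_eq_zero fun j hj => ?_
      simp [r]
    rw [h0, zero_add]
    congr 1
    ext j
    rw [add_comm m j, hσ]
    simp [r, norm_ex]
  rw [hb] at hcs
  refine hcs.trans ?_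
  calc _ ≤ 1 * Real.sqrt (∑' j, lam (m + j)) := by gcongr
    _ = _ := one_mul _


lemma rearr (lam : ℕ → ℝ) (hanti : Antitone lam) (hl : ∀ k, 0 < lam k) (m N : ℕ)
    (b : ℕ → ℝ) (hb0 : ∀ k, 0 ≤ b k) (hb1 : ∀ k, b k ≤ 1)
    (hsum : (N : ℝ) ≤ ∑ k ∈ Finset.range (m + N), b k) :
    ∑ j ∈ Finset.range N, lam (m + j) ≤ ∑ k ∈ Finset.range (m + N), lam k * b k := by
  rw [Finset.sum_range_add] at hsum ⊢
  have h1 : lam m * ∑ k ∈ Finset.range m, b k ≤ ∑ k ∈ Finset.range m, lam k * b k := by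
    rw [Finset.mul_sum]
    refine Finset.sum_le_sum fun k hk => ?_
    have := hb0 k
    have := hanti (Finset.mem_range.1 hk).le
    gcongr
  have h2 : ∑ j ∈ Finset.range N, (lam (m + j) - lam (m + j) * b (m + j)) ≤
      lam m * ∑ j ∈ Finset.range N, (1 - b (m + j)) := by
    rw [Finset.mul_sum]
    refine Finset.sum_le_sum fun k hk => ?_
    have h3 := hb1 (m + k)
    have h4 : lam (m + k) ≤ lam m := hanti (by omega)
    nlinarith
  rw [Finset.sum_sub_distrib] at h2
  rw [Finset.sum_sub_distrib] at h2
  simp only [Finset.sum_const, Finset.card_range, nsmul_eq_mul, mul_one] at h2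
  have := hl m
  nlinarith

/-- embedding of finitely supported coefficient vectors -/
def emb {d R : ℕ} (κ : Fin R → (Fin d → ℤ)) (y : Fin R → ℂ) : Coef d :=
  ∑ k, y k • lp.single 2 (κ k) (1 : ℂ)

lemma emb_apply {d R : ℕ} (κ : Fin R → (Fin d → ℤ)) (y : Fin R → ℂ) (l : Fin d → ℤ) :
    (emb κ y) l = ∑ k, if κ k = l then y k else 0 := by
  unfold emb
  rw [lp.coeFn_sum, Finset.sum_apply]
  refine Finset.sum_congr rfl fun k _ => ?_
  rw [lp.coeFn_smul, Pi.smul_apply, lp.single_apply]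
  by_cases h : κ k = l
  · subst h; simp
  · rw [Pi.single_eq_of_ne (Ne.symm h)]; simp [h]

lemma emb_self {d R : ℕ} (κ : Fin R → (Fin d → ℤ)) (hκ : Function.Injective κ) (y : Fin R → ℂ)
    (k : Fin R) : (emb κ y) (κ k) = y k := by
  rw [emb_apply, Finset.sum_eq_single k]
  · simp
  · intro l _ hl
    rw [if_neg (fun h => hl (hκ h))]
  · simp

lemma emb_ne {d R : ℕ} (κ : Fin R → (Fin d → ℤ)) (y : Fin R → ℂ)
    (l : Fin d → ℤ) (hl : l ∉ Finset.univ.image κ) : (emb κ y) l = 0 := by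
  rw [emb_apply]
  refine Finset.sum_eq_zero fun k _ => ?_
  rw [if_neg]
  rintro rfl
  exact hl (Finset.mem_image_of_mem _ (Finset.mem_univ _))

lemma emb_norm {d R : ℕ} (κ : Fin R → (Fin d → ℤ)) (hκ : Function.Injective κ) (y : Fin R → ℂ) :
    ‖emb κ y‖ ^ 2 = ∑ k, ‖y k‖ ^ 2 := by
  rw [← (coef_hasSum (emb κ y)).tsum_eq, tsum_eq_sum (s := Finset.univ.image κ),
    Finset.sum_image (fun a _ b _ h => hκ h)]
  · simp only [emb_self κ hκ]
  · intro l hl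
    rw [emb_ne κ y l hl]; simp

lemma emb_torus {d R : ℕ} (ω : (Fin d → ℤ) → ℝ) (κ : Fin R → (Fin d → ℤ))
    (hκ : Function.Injective κ) (y : Fin R → ℂ) (x : Fin d → ℝ) :
    torusFn ω (emb κ y) x = ∑ k, ((ω (κ k) : ℂ))⁻¹ * y k * ex (κ k) x := by
  rw [torusFn_eq, tsum_eq_sum (s := Finset.univ.image κ),
    Finset.sum_image (fun a _ b _ h => hκ h)]
  · simp only [emb_self κ hκ]
  · intro l hl
    rw [emb_ne κ y l hl]; simp

lemma all_low {d : ℕ} (ω : (Fin d → ℤ) → ℝ) (hω : ∀ k, 0 < ω k)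
    (lam : ℕ → ℝ) (hanti : Antitone lam) (σ : ℕ ≃ (Fin d → ℤ))
    (hσ : ∀ k, lam k = ((ω (σ k)) ^ 2)⁻¹) (m N : ℕ) (L : Fin m → Coef d →L[ℂ] ℂ) :
    ∃ u : Coef d, ‖u‖ ≤ 1 ∧ (∀ i, L i u = 0) ∧ ∃ x ∈ cube d,
      Real.sqrt (∑ j ∈ Finset.range N, lam (m + j)) ≤ ‖torusFn ω u x‖ := by
  have hl : ∀ k, 0 < lam k := fun k => by rw [hσ]; have := hω (σ k); positivity
  let κ : Fin (m + N) → (Fin d → ℤ) := fun k => σ k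
  have hκ : Function.Injective κ := σ.injective.comp Fin.val_injective
  let t : EuclideanSpace ℂ (Fin (m + N)) →ₗ[ℂ] (Fin m → ℂ) :=
    { toFun := fun y i => ∑ k, y k * L i (lp.single 2 (κ k) (1:ℂ))
      map_add' := fun y z => by
        ext i; simp [add_mul, Finset.sum_add_distrib]
      map_smul' := fun a y => by
        ext i; simp [Finset.mul_sum, mul_assoc] }
  let K := LinearMap.ker t
  have hfin : N ≤ Module.finrank ℂ K := by
    have h1 := t.finrank_range_add_finrank_ker
    have h2 : Module.finrank ℂ (LinearMap.range t) ≤ m := by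
      have := Submodule.finrank_le (LinearMap.range t)
      simpa using this
    rw [finrank_euclideanSpace_fin] at h1
    change N ≤ Module.finrank ℂ (LinearMap.ker t)
    omega
  let q := stdOrthonormalBasis ℂ K
  let Y : Fin (Module.finrank ℂ K) → Fin (m + N) → ℂ := fun j k => (q j : EuclideanSpace ℂ _) k
  have hon : Orthonormal ℂ (fun j => (q j : EuclideanSpace ℂ (Fin (m + N)))) :=
    q.orthonormal.comp_linearIsometry K.subtypeₗᵢ
  have hY : ∀ i j, ∑ k, star (Y i k) * Y j k = if i = j then 1 else 0 := by
    intro i j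
    have h := orthonormal_iff_ite.1 hon i j
    rw [← h, PiLp.inner_apply]
    refine Finset.sum_congr rfl fun k _ => ?_
    rw [RCLike.inner_apply, mul_comm]; rfl
  have hYker : ∀ j i, ∑ k, Y j k * L i (lp.single 2 (κ k) (1:ℂ)) = 0 := by
    intro j i
    have := (q j).2
    exact congrFun (LinearMap.mem_ker.1 this) i
  let B : Fin (m + N) → ℝ := fun k => ∑ j, ‖Y j k‖ ^ 2
  have hB1 : ∀ k, B k ≤ 1 := by
    intro k
    have h := hon.sum_inner_products_le (x := EuclideanSpace.single k (1:ℂ)) (s := Finset.univ)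
    simp only [EuclideanSpace.inner_single_right, one_mul, EuclideanSpace.norm_single, norm_one,
      one_pow, RCLike.norm_conj] at h
    exact h
  have hBsum : (N : ℝ) ≤ ∑ k, B k := by
    simp only [B]
    rw [Finset.sum_comm]
    have : ∀ j, ∑ k, ‖Y j k‖ ^ 2 = 1 := by
      intro j
      have h := hY j j
      rw [if_pos rfl] at h
      have h2 : ((∑ k, ‖Y j k‖ ^ 2 : ℝ) : ℂ) = 1 := by
        rw [← h]; push_cast
        refine Finset.sum_congr rfl fun k _ => ?_
        rw [← Complex.conj_mul']; rfl
      exact_mod_cast h2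
    simp only [this, Finset.sum_const, Finset.card_univ, Fintype.card_fin, nsmul_eq_mul, mul_one]
    exact_mod_cast hfin
  let s : Fin (m + N) → ℂ := fun k => ((ω (κ k) : ℂ))⁻¹
  let Q : Matrix (Fin (m + N)) (Fin (m + N)) ℂ := fun k l =>
    ∑ j, star (s k * Y j k) * (s l * Y j l)
  obtain ⟨x, hx, hQ⟩ := avg κ hκ Q
  let f : Fin (Module.finrank ℂ K) → ℂ := fun j => ∑ k, s k * Y j k * ex (κ k) x
  set g : ℝ := ∑ j, ‖f j‖ ^ 2 with hg
  have hg0 : 0 ≤ g := by positivity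
  have e1 : (star (fun k => ex (κ k) x) ⬝ᵥ (Q.mulVec (fun k => ex (κ k) x))) = (g : ℂ) := by
    have h1 : ∀ j, ((‖f j‖ ^ 2 : ℝ) : ℂ) = ∑ k, ∑ l, star (ex (κ k) x) *
        (star (s k * Y j k) * (s l * Y j l) * ex (κ l) x) := by
      intro j
      have : ((‖f j‖ ^ 2 : ℝ) : ℂ) = star (f j) * f j := by
        push_cast; rw [← Complex.conj_mul']; rfl
      rw [this]
      simp only [f]
      rw [star_sum, Finset.sum_mul_sum]
      refine Finset.sum_congr rfl fun k _ => Finset.sum_congr rfl fun l _ => ?_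
      rw [star_mul']
      ring
    rw [hg, Complex.ofReal_sum]
    simp only [h1]
    rw [Finset.sum_comm]
    simp only [dotProduct, Matrix.mulVec, Pi.star_apply, Q]
    refine Finset.sum_congr rfl fun k _ => ?_
    rw [Finset.sum_comm, Finset.mul_sum]
    refine Finset.sum_congr rfl fun l _ => ?_
    rw [Finset.sum_mul, Finset.mul_sum]
  have e2 : Q.trace.re = ∑ k : Fin (m + N), lam k * B k := by
    have : Q.trace = ((∑ k : Fin (m + N), lam k * B k : ℝ) : ℂ) := by
      rw [Matrix.trace, Complex.ofReal_sum]
      refine Finset.sum_congr rfl fun k _ => ?_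
      simp only [Matrix.diag, Q, B]
      rw [Finset.mul_sum, Complex.ofReal_sum]
      refine Finset.sum_congr rfl fun j _ => ?_
      rw [hσ]
      simp only [s, κ]
      have : star (((ω (σ k) : ℂ))⁻¹ * Y j k) * (((ω (σ k) : ℂ))⁻¹ * Y j k) =
        ((‖((ω (σ k) : ℂ))⁻¹ * Y j k‖ : ℂ)) ^ 2 := by
        rw [← Complex.conj_mul']; rfl
      rw [this, norm_mul, norm_inv, Complex.norm_real, Real.norm_of_nonneg (hω _).le]
      push_cast
      rw [mul_pow, inv_pow]
    rw [this, Complex.ofReal_re]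
  rw [e1, e2, Complex.ofReal_re] at hQ
  have htail : ∑ j ∈ Finset.range N, lam (m + j) ≤ g := by
    refine le_trans ?_ hQ
    let b : ℕ → ℝ := fun k => if h : k < m + N then B ⟨k, h⟩ else 0
    have hbB : ∀ k : Fin (m + N), b k = B k := fun k => by simp [b]
    have := rearr lam hanti hl m N b
      (fun k => by
        simp only [b]; split_ifs
        · exact Finset.sum_nonneg fun j _ => by positivity
        · exact le_rfl)
      (fun k => by
        simp only [b]; split_ifs
        · exact hB1 _
        · exact zero_le_one)
      (by
        rw [← Fin.sum_univ_eq_sum_range b]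
        simpa only [hbB] using hBsum)
    rw [← Fin.sum_univ_eq_sum_range (fun k => lam k * b k)] at this
    simpa only [hbB] using this
  have hsq : Real.sqrt (∑ j ∈ Finset.range N, lam (m + j)) ≤ Real.sqrt g := Real.sqrt_le_sqrt htail
  let a : ℂ := ((Real.sqrt g)⁻¹ : ℝ)
  let z : Fin (m + N) → ℂ := fun k => ∑ j, a * star (f j) * Y j k
  refine ⟨emb κ z, ?_, ?_, x, hx, hsq.trans (le_of_eq ?_)⟩
  · have h1 : ‖emb κ z‖ ^ 2 = (Real.sqrt g)⁻¹ ^ 2 * g := by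
      rw [emb_norm κ hκ]
      have : ((∑ k, ‖z k‖ ^ 2 : ℝ) : ℂ) = (((Real.sqrt g)⁻¹ ^ 2 * g : ℝ) : ℂ) := by
        have h2 : ((∑ k, ‖z k‖ ^ 2 : ℝ) : ℂ) = ∑ k, star (z k) * z k := by
          push_cast
          refine Finset.sum_congr rfl fun k _ => ?_
          rw [← Complex.conj_mul']; rfl
        rw [h2]
        have h3 : ∀ k, star (z k) * z k = ∑ i, ∑ j, (star (a * star (f i)) * (a * star (f j))) *
            (star (Y i k) * Y j k) := by
          intro k
          simp only [z]
          rw [star_sum, Finset.sum_mul_sum]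
          refine Finset.sum_congr rfl fun i _ => Finset.sum_congr rfl fun j _ => ?_
          rw [star_mul' (a * star (f i))]; ring
        simp only [h3]
        rw [Finset.sum_comm]
        have h4 : ∀ i, ∑ k, ∑ j, (star (a * star (f i)) * (a * star (f j))) *
            (star (Y i k) * Y j k) = star (a * star (f i)) * (a * star (f i)) := by
          intro i
          rw [Finset.sum_comm]
          simp only [← Finset.mul_sum, hY]
          simp
        simp only [h4]
        rw [hg, Finset.mul_sum, Complex.ofReal_sum]
        refine Finset.sum_congr rfl fun i _ => ?_
        have : star (a * star (f i)) * (a * star (f i)) = ((‖a * star (f i)‖ : ℂ)) ^ 2 := by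
          rw [← Complex.conj_mul']; rfl
        rw [this, norm_mul, norm_star]
        simp only [a]
        rw [Complex.norm_real, Real.norm_of_nonneg (by positivity), ← hg]
        push_cast
        ring
      exact_mod_cast this
    have h2 : ‖emb κ z‖ ^ 2 ≤ 1 := by
      rw [h1, inv_pow, Real.sq_sqrt hg0]
      exact inv_mul_le_one
    nlinarith [norm_nonneg (emb κ z)]
  · intro i
    unfold emb
    rw [map_sum]
    simp only [map_smul, smul_eq_mul, z, Finset.sum_mul]
    rw [Finset.sum_comm]
    refine Finset.sum_eq_zero fun j _ => ?_
    simp only [mul_assoc]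
    rw [← Finset.mul_sum, ← Finset.mul_sum, hYker, mul_zero, mul_zero]
  · rw [emb_torus ω κ hκ]
    have h1 : ∑ k, ((ω (κ k) : ℂ))⁻¹ * z k * ex (κ k) x = a * (g : ℂ) := by
      have h2 : ∀ k, ((ω (κ k) : ℂ))⁻¹ * z k * ex (κ k) x =
          ∑ j, a * star (f j) * (s k * Y j k * ex (κ k) x) := by
        intro k
        simp only [z, s]
        rw [Finset.mul_sum, Finset.sum_mul]
        refine Finset.sum_congr rfl fun j _ => ?_
        ring
      simp only [h2]
      rw [Finset.sum_comm]
      simp only [← Finset.mul_sum]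
      rw [hg, Complex.ofReal_sum, Finset.mul_sum]
      refine Finset.sum_congr rfl fun j _ => ?_
      change a * star (f j) * f j = _
      rw [mul_assoc]
      congr 1
      push_cast; rw [← Complex.conj_mul']; rfl
    rw [h1]
    simp only [a]
    rw [← Complex.ofReal_mul, Complex.norm_real, Real.norm_of_nonneg (by positivity)]
    rcases hg0.eq_or_lt with h | h
    · rw [← h]; simp
    · have h5 := Real.sqrt_pos.2 h
      nth_rewrite 3 [← Real.mul_self_sqrt hg0]
      field_simp

lemma torusFn_neg {d : ℕ} (ω : (Fin d → ℤ) → ℝ) (u : Coef d) (x : Fin d → ℝ) :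
    torusFn ω (-u) x = - torusFn ω u x := by
  rw [torusFn_eq, torusFn_eq, ← tsum_neg]
  congr 1
  ext k
  rw [lp.coeFn_neg, Pi.neg_apply]
  ring

lemma all_lower {d : ℕ} (ω : (Fin d → ℤ) → ℝ) (hω : ∀ k, 0 < ω k)
    (hs : Summable fun k => ((ω k) ^ 2)⁻¹) (lam : ℕ → ℝ) (hanti : Antitone lam)
    (σ : ℕ ≃ (Fin d → ℤ)) (hσ : ∀ k, lam k = ((ω (σ k)) ^ 2)⁻¹) (m : ℕ) :
    ENNReal.ofReal (Real.sqrt (∑' j, lam (m + j))) ≤ wcErr ω (allInfo d) m := by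
  have hsl : Summable lam := lam_summable hs hσ
  have hsm : Summable fun j => lam (m + j) := hsl.comp_injective (add_right_injective m)
  unfold wcErr
  refine le_iInf fun L => le_iInf fun hL => le_iInf fun φ => ?_
  choose Tl hTl using hL
  set e := ⨆ (u : Coef d) (_ : ‖u‖ ≤ 1) (x : Fin d → ℝ) (_ : x ∈ cube d),
      (‖torusFn ω u x - φ (fun i => L i u) x‖₊ : ℝ≥0∞) with he
  have hle : ∀ u : Coef d, ‖u‖ ≤ 1 → ∀ x ∈ cube d,
      (‖torusFn ω u x - φ (fun i => L i u) x‖₊ : ℝ≥0∞) ≤ e := by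
    intro u hu x hx
    rw [he]
    exact le_iSup_of_le u (le_iSup_of_le hu (le_iSup_of_le x (le_iSup_of_le hx le_rfl)))
  by_cases hetop : e = ⊤
  · rw [hetop]; exact le_top
  have hN : ∀ N, Real.sqrt (∑ j ∈ Finset.range N, lam (m + j)) ≤ e.toReal := by
    intro N
    obtain ⟨u, hu, hu0, x, hx, hux⟩ := all_low ω hω lam hanti σ hσ m N Tl
    have h1 := hle u hu x hx
    have h2 := hle (-u) (by rwa [norm_neg]) x hx
    have i1 : (fun i => L i u) = 0 := by
      ext i; rw [hTl i]; exact hu0 i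
    have i2 : (fun i => L i (-u)) = 0 := by
      ext i; rw [hTl i, map_neg, hu0 i]; simp
    rw [i1] at h1
    rw [i2, torusFn_neg] at h2
    have h1' := ENNReal.toReal_mono hetop h1
    have h2' := ENNReal.toReal_mono hetop h2
    simp only [ENNReal.coe_toReal, coe_nnnorm] at h1' h2'
    set A := torusFn ω u x
    set P := φ 0 x
    have h3 : ‖(A - P) - (-A - P)‖ ≤ ‖A - P‖ + ‖-A - P‖ := norm_sub_le _ _
    have h4 : (A - P) - (-A - P) = 2 * A := by ring
    rw [h4, norm_mul] at h3
    simp only [Complex.norm_ofNat] at h3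
    linarith
  have hlim : Tendsto (fun N => Real.sqrt (∑ j ∈ Finset.range N, lam (m + j))) atTop
      (nhds (Real.sqrt (∑' j, lam (m + j)))) :=
    (Real.continuous_sqrt.tendsto _).comp hsm.hasSum.tendsto_sum_nat
  have hfinal := le_of_tendsto' hlim hN
  rw [← ENNReal.ofReal_toReal hetop]
  exact ENNReal.ofReal_le_ofReal hfinal

/-- There are absolute constants `c₁, c₂ ∈ ℕ` such that for every `d`,
every weight `ω` with `∑ ω(k)⁻² < ∞` and every `m ∈ ℕ`,
`g_{c₁ m}(APP_{∞,d}) ≤ c₂ a_{m+1}(APP_{∞,d}) = c₂ (∑_{k ≥ m+1} λ_{k,d})^{1/2}`, i.e.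
`e(c₁ m; Λ^std) ≤ c₂ e(m; Λ^all)`, where `{λ_{k,d}}_{k ≥ 1}` is the nonincreasing
rearrangement of `{ω(k)⁻²}_{k ∈ ℤ^d}` (here `lam j = λ_{j+1,d}`). -/
theorem stmt1 :
    ∃ c₁ c₂ : ℕ, 0 < c₁ ∧ 0 < c₂ ∧
      ∀ (d : ℕ), 0 < d →
      ∀ ω : (Fin d → ℤ) → ℝ, (∀ k, 0 < ω k) → (Summable fun k => ((ω k) ^ 2)⁻¹) →
      ∀ lam : ℕ → ℝ, Antitone lam →
        (∃ σ : ℕ ≃ (Fin d → ℤ), ∀ k, lam k = ((ω (σ k)) ^ 2)⁻¹) →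
      ∀ m : ℕ, 0 < m →
        wcErr ω (stdInfo ω) (c₁ * m) ≤ (c₂ : ℝ≥0∞) * wcErr ω (allInfo d) m ∧
        wcErr ω (allInfo d) m = (∑' j : ℕ, ENNReal.ofReal (lam (m + j))) ^ (1 / 2 : ℝ) := by
  refine ⟨16, 3, by norm_num, by norm_num, ?_⟩
  intro d _ ω hω hs lam hanti ⟨σ, hσ⟩ m hm
  have hall : wcErr ω (allInfo d) m = ENNReal.ofReal (Real.sqrt (∑' j, lam (m + j))) :=
    le_antisymm (all_upper ω hω hs lam σ hσ m) (all_lower ω hω hs lam hanti σ hσ m)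
  have hl : ∀ k, 0 ≤ lam k := fun k => by rw [hσ]; have := hω (σ k); positivity
  have hsm : Summable fun j => lam (m + j) :=
    (lam_summable hs hσ).comp_injective (add_right_injective m)
  refine ⟨?_, ?_⟩
  · rw [hall]
    refine (std_bound ω hω hs lam σ hσ m hm).trans (le_of_eq ?_)
    rw [ENNReal.ofReal_mul (by norm_num)]
    norm_num
  · rw [hall, ← ENNReal.ofReal_tsum_of_nonneg (fun j => hl _) hsm,
      ENNReal.ofReal_rpow_of_nonneg (tsum_nonneg fun j => hl _) (by norm_num),
      Real.sqrt_eq_rpow]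
end
end

section
/- Consider the problem ${\rm APP} = \{{\rm APP}_{\infty,d}\}_{d \in \mathbb{N}}$ in the worst case setting for the absolute or normalized error criterion $\star \in \{{\rm ABS}, {\rm NOR}\}$. Then ${\rm APP}$ is algebraically strongly polynomially tractable (ALG-SPT) for $\Lambda^{\rm all}$ if and only if it is ALG-SPT for $\Lambda^{\rm std}$, and in this case the exponents of ALG-SPT coincide: ${\rm ALG}\text{-}p^{\star}(\Lambda^{\rm all}) = {\rm ALG}\text{-}p^{\star}(\Lambda^{\rm std})$. -/
open Filter
open scoped ENNReal NNReal

noncomputable section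

/-- Algebraic strong polynomial tractability of the family of information complexities `nc`. -/
def ALGSPT (nc : ℕ → ℝ → ℕ) : Prop :=
  ∃ C > (0:ℝ), ∃ p ≥ (0:ℝ), ∀ d : ℕ, 0 < d → ∀ ε ∈ Set.Ioo (0:ℝ) 1,
    (nc d ε : ℝ) ≤ C * ε ^ (-p)

/-- The exponent of algebraic strong polynomial tractability. -/
def ALGSPTexp (nc : ℕ → ℝ → ℕ) : ℝ :=
  sInf {p : ℝ | 0 ≤ p ∧ ∃ C > (0:ℝ), ∀ d : ℕ, 0 < d → ∀ ε ∈ Set.Ioo (0:ℝ) 1,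
    (nc d ε : ℝ) ≤ C * ε ^ (-p)}

/-- Algebraic polynomial tractability. -/
def ALGPT (nc : ℕ → ℝ → ℕ) : Prop :=
  ∃ C > (0:ℝ), ∃ p ≥ (0:ℝ), ∃ q ≥ (0:ℝ), ∀ d : ℕ, 0 < d → ∀ ε ∈ Set.Ioo (0:ℝ) 1,
    (nc d ε : ℝ) ≤ C * (d : ℝ) ^ q * ε ^ (-p)

/-- Algebraic quasi-polynomial tractability. -/
def ALGQPT (nc : ℕ → ℝ → ℕ) : Prop :=
  ∃ C > (0:ℝ), ∃ t ≥ (0:ℝ), ∀ d : ℕ, 0 < d → ∀ ε ∈ Set.Ioo (0:ℝ) 1,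
    (nc d ε : ℝ) ≤ C * Real.exp (t * (1 + Real.log d) * (1 + Real.log ε⁻¹))

/-- The exponent of algebraic quasi-polynomial tractability. -/
def ALGQPTexp (nc : ℕ → ℝ → ℕ) : ℝ :=
  sInf {t : ℝ | 0 ≤ t ∧ ∃ C > (0:ℝ), ∀ d : ℕ, 0 < d → ∀ ε ∈ Set.Ioo (0:ℝ) 1,
    (nc d ε : ℝ) ≤ C * Real.exp (t * (1 + Real.log d) * (1 + Real.log ε⁻¹))}

/-- Exponential quasi-polynomial tractability. -/
def EXPQPT (nc : ℕ → ℝ → ℕ) : Prop :=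
  ∃ C > (0:ℝ), ∃ t ≥ (0:ℝ), ∀ d : ℕ, 0 < d → ∀ ε ∈ Set.Ioo (0:ℝ) 1,
    (nc d ε : ℝ) ≤ C * Real.exp (t * (1 + Real.log d) * (1 + Real.log (Real.log ε⁻¹ + 1)))

/-- The exponent of exponential quasi-polynomial tractability. -/
def EXPQPTexp (nc : ℕ → ℝ → ℕ) : ℝ :=
  sInf {t : ℝ | 0 ≤ t ∧ ∃ C > (0:ℝ), ∀ d : ℕ, 0 < d → ∀ ε ∈ Set.Ioo (0:ℝ) 1,
    (nc d ε : ℝ) ≤ C * Real.exp (t * (1 + Real.log d) * (1 + Real.log (Real.log ε⁻¹ + 1)))}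

/-- `lim_{ε⁻¹ + d → ∞} (log nc(d, ε)) / den(d, ε) = 0`. -/
def WTlim (den : ℕ → ℝ → ℝ) (nc : ℕ → ℝ → ℕ) : Prop :=
  ∀ δ > (0:ℝ), ∃ M : ℝ, ∀ d : ℕ, 0 < d → ∀ ε ∈ Set.Ioo (0:ℝ) 1,
    M ≤ ε⁻¹ + d → |Real.log (nc d ε) / den d ε| < δ

/-- Algebraic `(s,t)`-weak tractability; `ALGWTst 1 1` is algebraic weak tractability. -/
def ALGWTst (s t : ℝ) (nc : ℕ → ℝ → ℕ) : Prop :=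
  WTlim (fun d ε => ε ^ (-s) + (d : ℝ) ^ t) nc

/-- Algebraic uniform weak tractability. -/
def ALGUWT (nc : ℕ → ℝ → ℕ) : Prop := ∀ α > (0:ℝ), ∀ β > (0:ℝ), ALGWTst α β nc

/-- Exponential `(s,t)`-weak tractability; `EXPWTst 1 1` is exponential weak tractability. -/
def EXPWTst (s t : ℝ) (nc : ℕ → ℝ → ℕ) : Prop :=
  WTlim (fun d ε => (1 + Real.log ε⁻¹) ^ s + (d : ℝ) ^ t) nc

/-- Exponential uniform weak tractability. -/
def EXPUWT (nc : ℕ → ℝ → ℕ) : Prop := ∀ α > (0:ℝ), ∀ β > (0:ℝ), EXPWTst α β nc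

section GreedyAbstract

open InnerProductSpace

variable {H : Type*} [NormedAddCommGroup H] [InnerProductSpace ℂ H]

def gV (f : ℕ → H) (n : ℕ) : Submodule ℂ H := Submodule.span ℂ (f '' Set.Iio n)

def gA (f : ℕ → H) (n : ℕ) : ℝ := ‖gramSchmidt ℂ f n‖

def Near (W : Submodule ℂ H) (t : ℝ) (v : H) : Prop := ∃ w ∈ W, ‖v - w‖ ≤ t

lemma gV_mono (f : ℕ → H) {m n : ℕ} (h : m ≤ n) : gV f m ≤ gV f n :=
  Submodule.span_mono (Set.image_mono (Set.Iio_subset_Iio h))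

lemma gV_fin (f : ℕ → H) (n : ℕ) : FiniteDimensional ℂ (gV f n) :=
  FiniteDimensional.span_of_finite ℂ ((Set.finite_Iio n).image f)

lemma gs_perp (f : ℕ → H) {n : ℕ} {v : H} (hv : v ∈ gV f n) :
    inner ℂ (gramSchmidt ℂ f n) v = 0 := by
  unfold gV at hv
  induction hv using Submodule.span_induction with
  | mem x hx =>
    obtain ⟨i, hi, rfl⟩ := hx
    exact gramSchmidt_inv_triangular ℂ f hi
  | zero => simp
  | add x y _ _ hx hy => rw [inner_add_right, hx, hy, add_zero]
  | smul a x _ hx => rw [inner_smul_right, hx, mul_zero]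

lemma gs_sub_mem (f : ℕ → H) (n : ℕ) : f n - gramSchmidt ℂ f n ∈ gV f n := by
  have h := gramSchmidt_def'' ℂ f n
  have : f n - gramSchmidt ℂ f n = ∑ i ∈ Finset.Iio n,
      (inner ℂ (gramSchmidt ℂ f i) (f n) / (‖gramSchmidt ℂ f i‖ : ℂ) ^ 2) • gramSchmidt ℂ f i := by
    rw [sub_eq_iff_eq_add']; exact h
  rw [this, gV, ← span_gramSchmidt_Iio ℂ f n]
  refine Submodule.sum_mem _ fun i hi => Submodule.smul_mem _ _ (Submodule.subset_span ?_)
  exact ⟨i, by simpa using hi, rfl⟩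

lemma gs_inner_self (f : ℕ → H) (n : ℕ) :
    inner ℂ (gramSchmidt ℂ f n) (f n) = ((gA f n) ^ 2 : ℝ) := by
  have : f n = gramSchmidt ℂ f n + (f n - gramSchmidt ℂ f n) := by abel
  have h2 : inner ℂ (gramSchmidt ℂ f n) (f n) = inner ℂ (gramSchmidt ℂ f n) (gramSchmidt ℂ f n)
      + inner ℂ (gramSchmidt ℂ f n) (f n - gramSchmidt ℂ f n) := by
    rw [← inner_add_right, ← this]
  rw [h2, gs_perp f (gs_sub_mem f n), add_zero, inner_self_eq_norm_sq_to_K]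
  simp [gA]

lemma gA_nonneg (f : ℕ → H) (n : ℕ) : 0 ≤ gA f n := norm_nonneg _

lemma gA_le_of_near (f : ℕ → H) {n : ℕ} {t : ℝ} (h : Near (gV f n) t (f n)) : gA f n ≤ t := by
  obtain ⟨w, hw, hwt⟩ := h
  have h1 : inner ℂ (gramSchmidt ℂ f n) (f n - w) = ((gA f n) ^ 2 : ℝ) := by
    rw [inner_sub_right, gs_perp f hw, sub_zero, gs_inner_self]
  have h2 := norm_inner_le_norm (𝕜 := ℂ) (gramSchmidt ℂ f n) (f n - w)
  rw [h1, Complex.norm_real, Real.norm_of_nonneg (sq_nonneg _)] at h2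
  change _ ≤ gA f n * _ at h2
  have h0 := gA_nonneg f n
  rcases h0.eq_or_lt with h | h
  · rw [← h]; exact (norm_nonneg _).trans hwt
  · nlinarith

lemma gA_le_two (f : ℕ → H) (hG : ∀ n i, Near (gV f n) (2 * gA f n) (f i)) {m n : ℕ}
    (h : m ≤ n) : gA f n ≤ 2 * gA f m := by
  obtain ⟨w, hw, h2⟩ := hG m n
  exact gA_le_of_near f ⟨w, gV_mono f h hw, h2⟩

lemma gs_inner_le (f : ℕ → H) (hG : ∀ n i, Near (gV f n) (2 * gA f n) (f i)) (j i : ℕ) :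
    ‖inner ℂ (gramSchmidt ℂ f j) (f i)‖ ≤ gA f j * (2 * gA f j) := by
  obtain ⟨w, hw, h2⟩ := hG j i
  have : inner ℂ (gramSchmidt ℂ f j) (f i) = inner ℂ (gramSchmidt ℂ f j) (f i - w) := by
    rw [inner_sub_right, gs_perp f hw, sub_zero]
  rw [this]
  refine (norm_inner_le_norm (𝕜 := ℂ) _ _).trans ?_
  exact mul_le_mul_of_nonneg_left h2 (norm_nonneg _)

/-- start lemma -/
lemma greedy_start (f : ℕ → H) (hG : ∀ n i, Near (gV f n) (2 * gA f n) (f i))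
    (W : Submodule ℂ H) [FiniteDimensional ℂ W] (n : ℕ) (hW : Module.finrank ℂ W ≤ n)
    (t : ℝ) (ht : ∀ i, Near W t (f i)) : gA f n ≤ 2 * 3 ^ (n + 1) * t := by
  choose w hwW hwt using ht
  have ht0 : 0 ≤ t := (norm_nonneg _).trans (hwt 0)
  rcases (gA_nonneg f n).eq_or_lt with h0 | h0
  · rw [← h0]; positivity
  -- dependence
  have hdep : ¬ LinearIndependent ℂ (fun i : Fin (n+1) => (⟨w i, hwW i⟩ : W)) := by
    intro hl
    have := hl.fintype_card_le_finrank
    simp at this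
    omega
  rw [Fintype.not_linearIndependent_iff] at hdep
  obtain ⟨g, hg, i0, hi0⟩ := hdep
  set c : ℕ → ℂ := fun i => if h : i < n + 1 then g ⟨i, h⟩ else 0 with hc
  have hsum : ∑ i ∈ Finset.range (n+1), c i • w i = 0 := by
    rw [Finset.sum_range]
    have := congrArg (Subtype.val) hg
    simp only [Submodule.coe_zero, Submodule.coe_sum, Submodule.coe_smul] at this
    rw [← this]
    refine Finset.sum_congr rfl fun i _ => ?_
    simp only [hc, dif_pos i.isLt]
  set S : ℕ → ℝ := fun j => ∑ i ∈ Finset.Ico j (n+1), ‖c i‖ with hS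
  have hS0 : 0 < S 0 := by
    refine Finset.sum_pos' (fun i _ => norm_nonneg _) ⟨i0, ?_, ?_⟩
    · simp only [Finset.mem_Ico]; exact ⟨Nat.zero_le _, i0.isLt⟩
    · simp only [hc, dif_pos i0.isLt]; exact norm_pos_iff.2 hi0
  set v : H := ∑ i ∈ Finset.Ico 0 (n+1), c i • f i with hv
  have hvn : ‖v‖ ≤ t * S 0 := by
    have : v = ∑ i ∈ Finset.Ico 0 (n+1), c i • (f i - w i) := by
      simp only [smul_sub, Finset.sum_sub_distrib]
      rw [← Finset.range_eq_Ico, hsum, sub_zero, hv, Finset.range_eq_Ico]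
    rw [this]
    refine (norm_sum_le _ _).trans ?_
    rw [hS, Finset.mul_sum]
    refine Finset.sum_le_sum fun i _ => ?_
    rw [norm_smul, mul_comm]
    exact mul_le_mul_of_nonneg_right (hwt i) (norm_nonneg _)
  set β : ℝ := 2 * ‖v‖ / gA f n with hβ
  have hβ0 : 0 ≤ β := by positivity
  have key : ∀ j, j ≤ n → ‖c j‖ ≤ β + 2 * S (j+1) := by
    intro j hj
    have haj := gA_le_two f hG hj
    have haj0 : 0 < gA f j := by linarith
    have e1 : inner ℂ (gramSchmidt ℂ f j) v =
        c j * ((gA f j)^2 : ℝ) + ∑ i ∈ Finset.Ico (j+1) (n+1),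
          c i * inner ℂ (gramSchmidt ℂ f j) (f i) := by
      rw [hv, ← Finset.sum_Ico_consecutive _ (Nat.zero_le j) (by omega : j ≤ n + 1),
        inner_add_right, inner_sum, inner_sum]
      rw [Finset.sum_eq_zero, zero_add, Finset.sum_eq_sum_Ico_succ_bot (by omega : j < n + 1)]
      · simp only [inner_smul_right, gs_inner_self]
      · intro i hi
        rw [inner_smul_right, gramSchmidt_inv_triangular ℂ f (by simpa using hi), mul_zero]
    have e2 : ‖c j‖ * (gA f j)^2 ≤ gA f j * ‖v‖ + (gA f j * (2 * gA f j)) * S (j+1) := by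
      have : c j * ((gA f j)^2 : ℝ) = inner ℂ (gramSchmidt ℂ f j) v -
          ∑ i ∈ Finset.Ico (j+1) (n+1), c i * inner ℂ (gramSchmidt ℂ f j) (f i) := by
        rw [e1]; ring
      have h3 := congrArg norm this
      rw [norm_mul, Complex.norm_real, Real.norm_of_nonneg (sq_nonneg _)] at h3
      rw [h3]
      refine (norm_sub_le _ _).trans (add_le_add (norm_inner_le_norm (𝕜 := ℂ) _ _) ?_)
      refine (norm_sum_le _ _).trans ?_
      rw [hS, Finset.mul_sum]
      refine Finset.sum_le_sum fun i _ => ?_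
      rw [norm_mul, mul_comm]
      exact mul_le_mul_of_nonneg_right (gs_inner_le f hG j i) (norm_nonneg _)
    have e3 : ‖v‖ ≤ β * gA f j := by
      have : ‖v‖ = β * (gA f n / 2) := by rw [hβ]; field_simp
      rw [this]
      exact mul_le_mul_of_nonneg_left (by linarith) hβ0
    have e4 : gA f j * ‖v‖ ≤ gA f j * (β * gA f j) := mul_le_mul_of_nonneg_left e3 haj0.le
    have e5 : ‖c j‖ * (gA f j)^2 ≤ (β + 2 * S (j+1)) * (gA f j)^2 := by nlinarith
    exact le_of_mul_le_mul_right e5 (by positivity)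
  have hSb : ∀ k, k ≤ n + 1 → S (n + 1 - k) ≤ β * (3 ^ k - 1) / 2 := by
    intro k
    induction k with
    | zero => intro _; simp [hS]
    | succ k ih =>
      intro hk
      have h1 := ih (by omega)
      have h2 := key (n + 1 - (k+1)) (by omega)
      have h3 : S (n + 1 - (k+1)) = ‖c (n+1-(k+1))‖ + S (n + 1 - k) := by
        simp only [hS]
        rw [Finset.sum_eq_sum_Ico_succ_bot (by omega)]
        congr 3
        omega
      rw [show n + 1 - (k+1) + 1 = n + 1 - k by omega] at h2
      rw [h3, pow_succ]
      nlinarith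
  have h1 := hSb (n+1) le_rfl
  rw [Nat.sub_self] at h1
  have h2 : S 0 ≤ β * 3 ^ (n+1) := by nlinarith
  have h3 : β * gA f n = 2 * ‖v‖ := by rw [hβ]; field_simp
  have h4 : S 0 * gA f n ≤ 2 * ‖v‖ * 3 ^ (n+1) := by
    calc S 0 * gA f n ≤ β * 3 ^ (n+1) * gA f n := mul_le_mul_of_nonneg_right h2 h0.le
      _ = (β * gA f n) * 3^(n+1) := by ring
      _ = _ := by rw [h3]
  have h5 : 2 * ‖v‖ * 3 ^ (n+1) ≤ 2 * (t * S 0) * 3 ^ (n+1) := by gcongr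
  have h6 : S 0 * gA f n ≤ S 0 * (2 * 3 ^ (n + 1) * t) := by linarith
  exact le_of_mul_le_mul_left h6 hS0

lemma sum_proj_le {ι : Type*} [Fintype ι] (φ : ι → H) (hφ : Orthonormal ℂ φ)
    (W : Submodule ℂ H) [FiniteDimensional ℂ W] :
    ∑ i, ‖W.starProjection (φ i)‖ ^ 2 ≤ Module.finrank ℂ W := by
  set b := stdOrthonormalBasis ℂ W
  have h1 : ∀ i, ‖W.starProjection (φ i)‖ ^ 2 = ∑ l, ‖inner ℂ (φ i) (b l : H)‖ ^ 2 := by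
    intro i
    have : ‖W.starProjection (φ i)‖ = ‖W.orthogonalProjectionOnto (φ i)‖ := by
      rw [Submodule.starProjection_apply]; rfl
    rw [this, ← b.sum_sq_norm_inner_right]
    refine Finset.sum_congr rfl fun l _ => ?_
    rw [Submodule.inner_orthogonalProjectionOnto_eq_of_mem_left, ← inner_conj_symm, RCLike.norm_conj]
  simp_rw [h1]
  rw [Finset.sum_comm]
  calc _ ≤ ∑ l : Fin (Module.finrank ℂ W), (1:ℝ) := by
        refine Finset.sum_le_sum fun l _ => ?_
        refine (hφ.sum_inner_products_le (b l : H)).trans ?_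
        have : ‖(b l : H)‖ = 1 := b.orthonormal.1 l
        rw [this]; norm_num
    _ = _ := by simp

/-- recursion lemma -/
lemma greedy_rec (f : ℕ → H) (hG : ∀ n i, Near (gV f n) (2 * gA f n) (f i))
    (W : Submodule ℂ H) [FiniteDimensional ℂ W] (N K : ℕ) (r : ℝ) (hr : 0 ≤ r) (hK : 0 < K)
    (hW : (Module.finrank ℂ W : ℝ) ≤ r ^ 2 * K)
    (t : ℝ) (ht : ∀ i, Near W t (f i)) : gA f (N + K) ≤ 4 * r * gA f N + 2 * t := by
  have ht0 : 0 ≤ t := by obtain ⟨w, _, h⟩ := ht 0; exact (norm_nonneg _).trans h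
  have hN0 := gA_nonneg f N
  by_contra! hcon
  have hbig : ∀ i : Fin K, 2 * r * gA f N + t < gA f (N + i) := by
    intro i
    have := gA_le_two f hG (show N + (i:ℕ) ≤ N + K by omega)
    linarith
  have hpos : ∀ i : Fin K, 0 < gA f (N + i) := fun i =>
    lt_of_le_of_lt (by positivity) (hbig i)
  have := gV_fin f N
  set Q : H →ₗ[ℂ] H := ((gV f N)ᗮ.starProjection : H →ₗ[ℂ] H) with hQ
  have hQn : ∀ v, ‖Q v‖ ≤ ‖v‖ := fun v => Submodule.norm_starProjection_apply_le _ v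
  have hQ0 : ∀ v ∈ gV f N, Q v = 0 := by
    intro v hv
    refine (Submodule.starProjection_apply_eq_zero_iff _).2 ?_
    exact Submodule.le_orthogonal_orthogonal _ hv
  set φ : Fin K → H := fun i => ((gA f (N+i))⁻¹ : ℂ) • gramSchmidt ℂ f (N + i) with hφdef
  have hφ : Orthonormal ℂ φ := by
    constructor
    · intro i
      simp only [hφdef, norm_smul]
      have := hpos i
      rw [norm_inv, Complex.norm_real, Real.norm_of_nonneg this.le]
      exact inv_mul_cancel₀ this.ne'
    · intro i j hij
      simp only [hφdef, inner_smul_left, inner_smul_right]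
      rw [gramSchmidt_orthogonal ℂ f (by simpa [Fin.ext_iff] using hij)]
      simp
  have hφQ : ∀ i v, inner ℂ (φ i) (Q v) = inner ℂ (φ i) v := by
    intro i v
    have : v - Q v ∈ gV f N := by
      rw [hQ]
      have := Submodule.starProjection_orthogonal_val (K := gV f N) v
      simp only [ContinuousLinearMap.coe_coe]
      rw [this]
      simp
    have h2 := gs_perp f (gV_mono f (Nat.le_add_right N i) this)
    have h3 : inner ℂ (φ i) (v - Q v) = 0 := by
      simp only [hφdef, inner_smul_left, h2, mul_zero]
    rw [inner_sub_right, sub_eq_zero] at h3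
    exact h3.symm
  have hφf : ∀ i : Fin K, ‖inner ℂ (φ i) (f (N + i))‖ = gA f (N+i) := by
    intro i
    have := hpos i
    simp only [hφdef, inner_smul_left, gs_inner_self]
    rw [norm_mul, RCLike.norm_conj, norm_inv, Complex.norm_real, Complex.norm_real,
      Real.norm_of_nonneg this.le, Real.norm_of_nonneg (sq_nonneg _)]
    field_simp
  set W' := W.map Q with hW'
  have hfin : Module.finrank ℂ W' ≤ Module.finrank ℂ W := Submodule.finrank_map_le Q W
  have hs := sum_proj_le φ hφ W'
  have hb : ∀ i : Fin K, r < ‖W'.starProjection (φ i)‖ := by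
    intro i
    obtain ⟨w, hw, hwt⟩ := ht (N + i)
    obtain ⟨v, hv, hvt⟩ := hG N (N + i)
    set g := Q (f (N + i)) with hg
    have hgn : ‖g‖ ≤ 2 * gA f N := by
      have : g = Q (f (N+i) - v) := by rw [map_sub, hQ0 v hv, sub_zero]
      rw [this]; exact (hQn _).trans hvt
    have hgw : ‖g - W'.starProjection g‖ ≤ t := by
      rw [Submodule.starProjection_minimal]
      refine (ciInf_le ⟨0, ?_⟩ (⟨Q w, Submodule.mem_map_of_mem hw⟩ : W')).trans ?_
      · rintro _ ⟨y, rfl⟩; exact norm_nonneg _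
      · change ‖g - Q w‖ ≤ t
        rw [hg, ← map_sub]; exact (hQn _).trans hwt
    have h1 : inner ℂ (φ i) (f (N+i)) =
        inner ℂ (W'.starProjection (φ i)) g + inner ℂ (φ i) (g - W'.starProjection g) := by
      rw [Submodule.inner_starProjection_left_eq_right, ← inner_add_right, ← hφQ]
      congr 1; abel
    have h2 := hφf i
    rw [h1] at h2
    have h3 := norm_add_le (inner ℂ (W'.starProjection (φ i)) g)
      (inner ℂ (φ i) (g - W'.starProjection g))
    have h4 := norm_inner_le_norm (𝕜 := ℂ) (W'.starProjection (φ i)) g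
    have h5 := norm_inner_le_norm (𝕜 := ℂ) (φ i) (g - W'.starProjection g)
    rw [hφ.1 i, one_mul] at h5
    have h6 := hbig i
    by_contra! hle
    have h7 : ‖W'.starProjection (φ i)‖ * ‖g‖ ≤ r * (2 * gA f N) := by gcongr
    linarith
  have : r ^ 2 * K < ∑ i, ‖W'.starProjection (φ i)‖ ^ 2 := by
    calc r^2 * K = ∑ i : Fin K, r ^ 2 := by simp [mul_comm]
      _ < _ := by
        have : Nonempty (Fin K) := ⟨⟨0, hK⟩⟩
        exact Finset.sum_lt_sum_of_nonempty Finset.univ_nonempty fun i _ => by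
          have := hb i; gcongr
  have h8 : (Module.finrank ℂ W' : ℝ) ≤ Module.finrank ℂ W := by exact_mod_cast hfin
  linarith

/-- existence of weak greedy sequence -/
lemma exists_greedy {X : Type*} [Nonempty X] (k : X → H) (R : ℝ) (hR : ∀ x, ‖k x‖ ≤ R) :
    ∃ x : ℕ → X, ∀ n y, Near (gV (fun i => k (x i)) n) (2 * gA (fun i => k (x i)) n) (k y) := by
  have hsel : ∀ V : Submodule ℂ H, ∃ x, ∀ y, Metric.infDist (k y) V ≤ 2 * Metric.infDist (k x) V := by
    intro V
    have hb : BddAbove (Set.range fun y => Metric.infDist (k y) (V : Set H)) := by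
      refine ⟨R, ?_⟩
      rintro _ ⟨y, rfl⟩
      refine (Metric.infDist_le_dist_of_mem (V.zero_mem)).trans ?_
      simpa using hR y
    by_cases h0 : ∀ y, Metric.infDist (k y) (V : Set H) = 0
    · refine ⟨Classical.arbitrary X, fun y => ?_⟩
      simp [h0]
    · push Not at h0
      obtain ⟨y0, hy0⟩ := h0
      have hp : 0 < Metric.infDist (k y0) (V : Set H) := lt_of_le_of_ne Metric.infDist_nonneg (Ne.symm hy0)
      have hs : 0 < ⨆ y, Metric.infDist (k y) (V : Set H) := hp.trans_le (le_ciSup hb y0)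
      obtain ⟨x, hx⟩ := exists_lt_of_lt_ciSup (half_lt_self hs)
      exact ⟨x, fun y => by have := le_ciSup hb y; linarith⟩
  choose g hg using hsel
  let V : ℕ → Submodule ℂ H := fun n => Nat.rec ⊥ (fun _ V => V ⊔ Submodule.span ℂ {k (g V)}) n
  have hV : ∀ n, gV (fun i => k (g (V i))) n = V n := by
    intro n
    induction n with
    | zero => simp [gV, V]
    | succ n ih =>
      change _ = V n ⊔ Submodule.span ℂ {k (g (V n))}
      rw [← ih, gV, gV, ← Submodule.span_union]
      congr 1
      ext z
      simp only [Set.mem_image, Set.mem_Iio, Set.mem_union, Set.mem_singleton_iff, Nat.lt_succ_iff_lt_or_eq]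
      constructor
      · rintro ⟨i, hi | rfl, rfl⟩
        · exact Or.inl ⟨i, hi, rfl⟩
        · right; rw [← ih]; rfl
      · rintro (⟨i, hi, rfl⟩ | rfl)
        · exact ⟨i, Or.inl hi, rfl⟩
        · refine ⟨n, Or.inr rfl, ?_⟩
          rw [← ih]; rfl
  refine ⟨fun n => g (V n), fun n y => ?_⟩
  set f : ℕ → H := fun i => k (g (V i)) with hf
  have := gV_fin f n
  have h1 := hg (V n) y
  have h2 : Metric.infDist (k (g (V n))) (SetLike.coe (V n)) ≤ gA f n := by
    refine (Metric.infDist_le_dist_of_mem (y := f n - gramSchmidt ℂ f n) ?_).trans ?_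
    · rw [← hV n]; exact gs_sub_mem f n
    · rw [dist_eq_norm]; simp [hf, gA]
  have h3 : ‖k y - (gV f n).starProjection (k y)‖ ≤ Metric.infDist (k y) (SetLike.coe (V n)) := by
    rw [← hV n, Submodule.starProjection_minimal, Metric.infDist_eq_iInf]
    simp only [dist_eq_norm]
    rfl
  exact ⟨_, Submodule.starProjection_apply_mem _ _, by linarith⟩

end GreedyAbstract

section Core

variable {H : Type*} [NormedAddCommGroup H] [InnerProductSpace ℂ H]

lemma greedy_tendsto {X : Type*} [Nonempty X] (k : X → H) (R : ℝ) (hR : ∀ x, ‖k x‖ ≤ R)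
    (hW : ∀ δ : ℝ, 0 < δ → ∃ W : Submodule ℂ H, FiniteDimensional ℂ W ∧ ∀ x, Near W δ (k x))
    (s : ℝ) (hs : 0 < s) :
    ∃ (n : ℕ) (x : ℕ → X), ∀ y, Near (gV (fun i => k (x i)) n) s (k y) := by
  obtain ⟨x, hx⟩ := exists_greedy k R hR
  set f : ℕ → H := fun i => k (x i) with hf
  have hR0 : 0 ≤ R := (norm_nonneg _).trans (hR (Classical.arbitrary X))
  have hG : ∀ n i, Near (gV f n) (2 * gA f n) (f i) := fun n i => hx n (x i)
  obtain ⟨W, hWf, hWn⟩ := hW (s / 8) (by positivity)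
  set r : ℝ := s / (16 * (R + 1)) with hr
  have hr0 : 0 < r := by positivity
  obtain ⟨K, hK⟩ := exists_nat_gt ((Module.finrank ℂ W : ℝ) / r ^ 2)
  have hK0 : 0 < K := by
    have : (0:ℝ) < K := lt_of_le_of_lt (by positivity) hK
    exact_mod_cast this
  have h1 := greedy_rec f hG W 0 K r hr0.le hK0 (by
    rw [div_lt_iff₀ (by positivity)] at hK; linarith) (s/8) (fun i => hWn _)
  have h0 : gA f 0 ≤ R := gA_le_of_near f ⟨0, Submodule.zero_mem _, by simpa using hR (x 0)⟩
  have h2 : 4 * r * gA f 0 ≤ s / 4 := by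
    calc 4 * r * gA f 0 ≤ 4 * r * (R + 1) := by gcongr; linarith
      _ = s / 4 := by rw [hr]; field_simp; norm_num
  refine ⟨K, x, fun y => ?_⟩
  obtain ⟨w, hw, hwn⟩ := hx K y
  rw [zero_add] at h1
  exact ⟨w, hw, by linarith⟩

lemma greedy_rate (C p : ℝ) (hC : 0 < C) (hp : 0 < p) : ∃ C' : ℝ, 0 < C' ∧
    ∀ (H : Type) [NormedAddCommGroup H] [InnerProductSpace ℂ H] (X : Type) [Nonempty X]
      (k : X → H) (R : ℝ) (_ : ∀ x, ‖k x‖ ≤ R) (s : ℝ) (_ : 0 < s)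
      (_ : ∀ ε ∈ Set.Ioo (0:ℝ) 1, ∃ W : Submodule ℂ H, FiniteDimensional ℂ W ∧
        (Module.finrank ℂ W : ℝ) ≤ C * ε ^ (-p) ∧ ∀ x, Near W (2 * ε * s) (k x)),
      ∀ ε ∈ Set.Ioo (0:ℝ) 1, ∃ (n : ℕ) (x : ℕ → X), (n : ℝ) ≤ C' * ε ^ (-p) ∧
        ∀ y, Near (gV (fun i => k (x i)) n) (ε * s) (k y) := by
  set m : ℕ := ⌊C * 2 ^ p⌋₊ with hm
  set B : ℝ := 16 + 4 * 3 ^ (m + 1) with hB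
  have h2p : (1:ℝ) < 2 ^ p := Real.one_lt_rpow (by norm_num) hp
  have h2p' : 0 < (2:ℝ) ^ p - 1 := by linarith
  set A : ℝ := C + (256 * C + 1) / (2 ^ p - 1) with hA
  have hA0 : 0 < A := by positivity
  have hB0 : 0 < B := by positivity
  have hB16 : 16 ≤ B := by rw [hB]; have : (0:ℝ) < 4 * 3 ^ (m+1) := by positivity
                           linarith
  refine ⟨A * (4 * B) ^ p, by positivity, ?_⟩
  intro H _ _ X _ k R hR s hs hW ε hε
  obtain ⟨x, hx⟩ := exists_greedy k R hR
  set f : ℕ → H := fun i => k (x i) with hf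
  have hG : ∀ n i, Near (gV f n) (2 * gA f n) (f i) := fun n i => hx n (x i)
  have hpow : ∀ j : ℕ, (((1/2:ℝ)) ^ (j+1)) ^ (-p) = ((2:ℝ) ^ (j+1)) ^ p := by
    intro j
    rw [Real.rpow_neg (by positivity), ← Real.inv_rpow (by positivity)]
    congr 1
    rw [← inv_pow]; norm_num
  have hdyad : ∀ j : ℕ, ∃ n : ℕ, (n : ℝ) ≤ A * ((2:ℝ) ^ (j+1)) ^ p ∧
      gA f n ≤ B * (1/2) ^ (j+1) * s := by
    intro j
    induction j with
    | zero =>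
      obtain ⟨W, hWf, hWr, hWn⟩ := hW (1/2) (by norm_num)
      have hp0 := hpow 0
      norm_num at hp0
      norm_num at hWr
      rw [hp0] at hWr
      have hfr : Module.finrank ℂ W ≤ m := Nat.le_floor hWr
      refine ⟨m, ?_, ?_⟩
      · have : (m:ℝ) ≤ C * 2 ^ p := Nat.floor_le (by positivity)
        have h3 : C ≤ A := by
          rw [hA]
          have : 0 < (256 * C + 1) / (2 ^ p - 1) := by positivity
          linarith
        norm_num
        exact this.trans (by gcongr)
      · have := greedy_start f hG W m hfr (2 * (1/2) * s) (fun i => hWn _)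
        refine this.trans ?_
        rw [hB]
        nlinarith
    | succ j ih =>
      obtain ⟨N, hN1, hN2⟩ := ih
      have hmem : ((1/2:ℝ)) ^ (j+1) ∈ Set.Ioo (0:ℝ) 1 :=
        ⟨by positivity, pow_lt_one₀ (by norm_num) (by norm_num) (by omega)⟩
      obtain ⟨W, hWf, hWr, hWn⟩ := hW _ hmem
      rw [hpow] at hWr
      have := greedy_rec f hG W N (256 * Module.finrank ℂ W + 1) (1/16) (by norm_num) (by omega)
        (by push_cast; norm_num; linarith) _ (fun i => hWn _)
      refine ⟨N + (256 * Module.finrank ℂ W + 1), ?_, ?_⟩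
      · push_cast
        set T : ℝ := ((2:ℝ) ^ (j+1)) ^ p with hT
        have hT1 : 1 ≤ T := Real.one_le_rpow (one_le_pow₀ (by norm_num)) hp.le
        have e : ((2:ℝ) ^ (j+1+1)) ^ p = T * 2 ^ p := by
          rw [pow_succ, Real.mul_rpow (by positivity) (by norm_num)]
        rw [e]
        have hA' : 256 * C + 1 ≤ A * (2 ^ p - 1) := by
          rw [hA, add_mul, div_mul_cancel₀ _ h2p'.ne']
          have : 0 < C * (2 ^ p - 1) := by positivity
          linarith
        have := mul_le_mul_of_nonneg_right hA' (by linarith : (0:ℝ) ≤ T)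
        nlinarith
      · refine this.trans ?_
        rw [pow_succ (1/2:ℝ) (j+1)]
        set q : ℝ := (1/2:ℝ)^(j+1)
        have hq : 0 < q * s := mul_pos (by positivity) hs
        nlinarith
  obtain ⟨hε0, hε1⟩ := hε
  obtain ⟨i, hi1, hi2⟩ := exists_nat_pow_near (x := 2 * B / ε) (y := (2:ℝ))
    (by rw [le_div_iff₀ hε0]; linarith) (by norm_num)
  obtain ⟨n, hn1, hn2⟩ := hdyad i
  refine ⟨n, x, ?_, ?_⟩
  · refine hn1.trans ?_
    have : ((2:ℝ) ^ (i+1)) ^ p ≤ (4 * B / ε) ^ p := by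
      refine Real.rpow_le_rpow (by positivity) ?_ hp.le
      rw [pow_succ]
      have : 4 * B / ε = 2 * B / ε * 2 := by ring
      rw [this]
      gcongr
    calc _ ≤ A * (4 * B / ε) ^ p := by gcongr
      _ = _ := by
        rw [Real.div_rpow (by positivity) hε0.le, Real.rpow_neg hε0.le]
        ring
  · intro y
    obtain ⟨w, hw, hwn⟩ := hx n y
    refine ⟨w, hw, hwn.trans ?_⟩
    have h3 : 2 * B * (1/2) ^ (i+1) ≤ ε := by
      rw [div_lt_iff₀ hε0] at hi2
      rw [one_div, inv_pow, ← div_eq_mul_inv, div_le_iff₀ (by positivity)]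
      linarith
    calc 2 * gA f n ≤ 2 * (B * (1/2) ^ (i+1) * s) := by gcongr
      _ = (2 * B * (1/2) ^ (i+1)) * s := by ring
      _ ≤ ε * s := by gcongr

end Core

section Bridge

lemma exists_kern {d : ℕ} (ω : (Fin d → ℤ) → ℝ) (hpos : ∀ k, 0 < ω k)
    (hsum : Summable fun k => ((ω k) ^ 2)⁻¹) :
    ∃ K : (Fin d → ℝ) → Coef d, (∀ x u, torusFn ω u x = inner ℂ (K x) u) ∧
      ∀ x k, ‖K x k‖ = (ω k)⁻¹ := by
  have hn : ∀ (x : Fin d → ℝ) (k : Fin d → ℤ), ‖(starRingEnd ℂ) (((ω k : ℂ))⁻¹ *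
      Complex.exp (2 * Real.pi * Complex.I * ∑ j, (k j : ℂ) * (x j : ℂ)))‖ = (ω k)⁻¹ := by
    intro x k
    rw [RCLike.norm_conj, norm_mul, norm_inv, Complex.norm_real, Real.norm_of_nonneg (hpos k).le]
    have : (2 * Real.pi * Complex.I * ∑ j, (k j : ℂ) * (x j : ℂ)) =
        ((2 * Real.pi * ∑ j, (k j : ℝ) * x j : ℝ) : ℂ) * Complex.I := by
      push_cast; ring
    rw [this, Complex.norm_exp_ofReal_mul_I, mul_one]
  refine ⟨fun x => ⟨fun k => (starRingEnd ℂ) (((ω k : ℂ))⁻¹ *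
      Complex.exp (2 * Real.pi * Complex.I * ∑ j, (k j : ℂ) * (x j : ℂ))), ?_⟩, ?_, ?_⟩
  · refine memℓp_gen ?_
    simp only [hn]
    refine hsum.congr fun k => ?_
    simp
  · intro x u
    rw [lp.inner_eq_tsum, torusFn]
    refine tsum_congr fun k => ?_
    simp only [RCLike.inner_apply, RCLike.conj_conj]
    ring
  · intro x k
    exact hn x k

lemma kern_tail {d : ℕ} (ω : (Fin d → ℤ) → ℝ)
    (hsum : Summable fun k => ((ω k) ^ 2)⁻¹) (K : (Fin d → ℝ) → Coef d)
    (hK : ∀ x k, ‖K x k‖ = (ω k)⁻¹) (δ : ℝ) (hδ : 0 < δ) :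
    ∃ W : Submodule ℂ (Coef d), FiniteDimensional ℂ W ∧ ∀ x, Near W δ (K x) := by
  classical
  have h2 : (0:ℝ) < (2:ℝ≥0∞).toReal := by norm_num
  obtain ⟨S, hS⟩ := ((hsum.hasSum.eventually (lt_mem_nhds
    (show (∑' k, ((ω k) ^ 2)⁻¹) - δ ^ 2 < ∑' k, ((ω k) ^ 2)⁻¹ by
      have : 0 < δ ^ 2 := by positivity
      linarith)))).exists
  refine ⟨Submodule.span ℂ ((fun k => (lp.single 2 k (1:ℂ) : Coef d)) '' (S : Set (Fin d → ℤ))),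
    FiniteDimensional.span_of_finite ℂ (S.finite_toSet.image _), fun x => ?_⟩
  refine ⟨∑ i ∈ S, lp.single 2 i (K x i), ?_, ?_⟩
  · refine Submodule.sum_mem _ fun i hi => ?_
    have : (lp.single 2 i (K x i) : Coef d) = (K x i) • (lp.single 2 i (1:ℂ) : Coef d) := by
      rw [← lp.single_smul]; simp
    rw [this]
    exact Submodule.smul_mem _ _ (Submodule.subset_span ⟨i, hi, rfl⟩)
  · have h := lp.norm_compl_sum_single h2 (K x) S
    rw [lp.norm_rpow_eq_tsum h2 (K x)] at h
    simp only [hK] at h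
    norm_num at h
    have h3 : ‖K x - ∑ i ∈ S, lp.single 2 i (K x i)‖ ^ 2 ≤ δ ^ 2 := by
      rw [h]; linarith
    exact le_of_sq_le_sq h3 hδ.le

lemma kern_norm {d : ℕ} (ω : (Fin d → ℤ) → ℝ) (K : (Fin d → ℝ) → Coef d)
    (hK : ∀ x k, ‖K x k‖ = (ω k)⁻¹) (x : Fin d → ℝ) : ‖K x‖ = ‖K 0‖ := by
  have h2 : (0:ℝ) < (2:ℝ≥0∞).toReal := by norm_num
  rw [lp.norm_eq_tsum_rpow h2, lp.norm_eq_tsum_rpow h2]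
  simp only [hK]

lemma std_le {d : ℕ} (ω : (Fin d → ℤ) → ℝ) (K : (Fin d → ℝ) → Coef d)
    (hK : ∀ x u, torusFn ω u x = inner ℂ (K x) u) (n : ℕ) (x : ℕ → cube d) (t : ℝ)
    (h : ∀ y : cube d, Near (gV (fun i => K (x i)) n) t (K y)) :
    wcErr ω (stdInfo ω) n ≤ ENNReal.ofReal t := by
  have h' : ∀ y : Fin d → ℝ, ∃ c : Fin n → ℂ, y ∈ cube d →
      ‖K y - ∑ i, c i • K (x i)‖ ≤ t := by
    intro y
    by_cases hy : y ∈ cube d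
    · obtain ⟨w, hw, hwt⟩ := h ⟨y, hy⟩
      have e : gV (fun i => K (x i)) n =
          Submodule.span ℂ (Set.range fun i : Fin n => K (x i)) := by
        rw [gV]; congr 1; ext z
        simp only [Set.mem_image, Set.mem_Iio, Set.mem_range]
        exact ⟨fun ⟨i, hi, hz⟩ => ⟨⟨i, hi⟩, hz⟩, fun ⟨i, hz⟩ => ⟨i, i.isLt, hz⟩⟩
      rw [e] at hw
      obtain ⟨c, rfl⟩ := (Submodule.mem_span_range_iff_exists_fun ℂ).1 hw
      exact ⟨c, fun _ => hwt⟩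
    · exact ⟨0, fun h => absurd h hy⟩
  choose c hc using h'
  unfold wcErr
  refine iInf_le_of_le (fun i u => torusFn ω u (x i)) ?_
  refine iInf_le_of_le (fun i => ⟨x i, (x i).2, rfl⟩) ?_
  refine iInf_le_of_le (fun y z => ∑ i, (starRingEnd ℂ) (c z i) * y i) ?_
  refine iSup_le fun u => iSup_le fun hu => iSup_le fun z => iSup_le fun hz => ?_
  have e : torusFn ω u z - ∑ i, (starRingEnd ℂ) (c z i) * torusFn ω u (x i) =
      inner ℂ (K z - ∑ i, c z i • K (x i)) u := by
    rw [inner_sub_left, sum_inner]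
    simp only [hK, inner_smul_left]
  rw [e, ← enorm_eq_nnnorm, ← ofReal_norm]
  refine ENNReal.ofReal_le_ofReal ((norm_inner_le_norm _ _).trans ?_)
  have := hc z hz
  calc _ ≤ ‖K z - ∑ i, c z i • K (x i)‖ * 1 := by gcongr
    _ ≤ t := by linarith

lemma near_of_all {d : ℕ} (ω : (Fin d → ℤ) → ℝ) (K : (Fin d → ℝ) → Coef d)
    (hK : ∀ x u, torusFn ω u x = inner ℂ (K x) u) (n : ℕ) (t : ℝ) (ht : 0 < t)
    (h : wcErr ω (allInfo d) n < ENNReal.ofReal t) :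
    ∃ W : Submodule ℂ (Coef d), FiniteDimensional ℂ W ∧ Module.finrank ℂ W ≤ n ∧
      ∀ x : cube d, Near W t (K x) := by
  unfold wcErr at h
  simp only [iInf_lt_iff] at h
  obtain ⟨L, hL, φ, hφ⟩ := h
  choose T hT using hL
  set g : Fin n → Coef d := fun i => (InnerProductSpace.toDual ℂ (Coef d)).symm (T i) with hg
  set W : Submodule ℂ (Coef d) := Submodule.span ℂ (Set.range g) with hWdef
  have hWf : FiniteDimensional ℂ W := FiniteDimensional.span_of_finite ℂ (Set.finite_range g)
  refine ⟨W, hWf, ?_, fun x => ?_⟩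
  · have := finrank_range_le_card (R := ℂ) g
    simpa [Set.finrank] using this
  · have hb : ∀ u : Coef d, ‖u‖ ≤ 1 → ‖torusFn ω u x - φ (fun i => L i u) x‖ ≤ t := by
      intro u hu
      have h1 : (‖torusFn ω u x - φ (fun i => L i u) x‖₊ : ℝ≥0∞) ≤ ENNReal.ofReal t := by
        refine le_trans ?_ hφ.le
        exact le_iSup₂_of_le u hu (le_iSup₂_of_le (x : Fin d → ℝ) x.2 le_rfl)
      rw [← enorm_eq_nnnorm, ← ofReal_norm] at h1
      exact (ENNReal.ofReal_le_ofReal_iff ht.le).1 h1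
    refine ⟨W.starProjection (K x), Submodule.starProjection_apply_mem _ _, ?_⟩
    set v := K x - W.starProjection (K x) with hv
    by_cases hv0 : ‖v‖ = 0
    · rw [hv0]; exact ht.le
    set u : Coef d := ((‖v‖⁻¹ : ℝ) : ℂ) • v with hu
    have hun : ‖u‖ ≤ 1 := by
      rw [hu, norm_smul, Complex.norm_real, norm_inv, norm_norm, inv_mul_cancel₀ hv0]
    have hTv : ∀ i, T i v = 0 := by
      intro i
      have : T i v = inner ℂ (g i) v := by
        rw [hg, InnerProductSpace.toDual_symm_apply]
      rw [this, ← inner_conj_symm, hv, Submodule.starProjection_inner_eq_zero, map_zero]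
      exact Submodule.subset_span ⟨i, rfl⟩
    have hLu : (fun i => L i u) = 0 := by
      ext i; rw [hT i, hu, map_smul, hTv]; simp
    have hLu' : (fun i => L i (-u)) = 0 := by
      ext i; rw [hT i, map_neg, hu, map_smul, hTv]; simp
    have h1 := hb u hun
    have h2 := hb (-u) (by rwa [norm_neg])
    rw [hLu] at h1
    rw [hLu', hK, inner_neg_right] at h2
    rw [hK] at h1
    have h3 : ‖inner ℂ (K x) u‖ = ‖v‖ := by
      have e : K x = v + W.starProjection (K x) := by rw [hv]; abel
      have e2 : inner ℂ (W.starProjection (K x)) v = 0 := by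
        rw [← inner_conj_symm, hv, Submodule.starProjection_inner_eq_zero, map_zero]
        exact Submodule.starProjection_apply_mem _ _
      have e3 : inner ℂ (K x) v = inner ℂ v v := by
        conv_lhs => rw [e]
        rw [inner_add_left, e2, add_zero]
      rw [hu, inner_smul_right, e3, inner_self_eq_norm_sq_to_K, norm_mul, Complex.norm_real,
        norm_inv, norm_norm]
      simp only [Complex.coe_algebraMap, norm_pow, Complex.norm_real, norm_norm]
      field_simp
    set z := inner ℂ (K x) u
    set a := φ 0 x
    have h4 : ‖z - a - (-z - a)‖ ≤ ‖z - a‖ + ‖-z - a‖ := norm_sub_le _ _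
    have h5 : z - a - (-z - a) = 2 * z := by ring
    rw [h5, norm_mul, h3] at h4
    norm_num at h4
    linarith

lemma all_le_std {d : ℕ} (ω : (Fin d → ℤ) → ℝ) (K : (Fin d → ℝ) → Coef d)
    (hK : ∀ x u, torusFn ω u x = inner ℂ (K x) u) (n : ℕ) :
    wcErr ω (allInfo d) n ≤ wcErr ω (stdInfo ω) n := by
  unfold wcErr
  refine le_iInf fun L => le_iInf fun hL => ?_
  refine iInf_le_of_le L (iInf_le_of_le ?_ le_rfl)
  intro i
  obtain ⟨x, hx, h⟩ := hL i
  refine ⟨innerSL ℂ (K x), ?_⟩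
  rw [h]; ext u; rw [hK]; rfl

lemma cube_zero (d : ℕ) : (0 : Fin d → ℝ) ∈ cube d := fun j => by simp

lemma CRI_pos {d : ℕ} (ω : (Fin d → ℤ) → ℝ) (hpos : ∀ k, 0 < ω k) (K : (Fin d → ℝ) → Coef d)
    (hK : ∀ x u, torusFn ω u x = inner ℂ (K x) u) (hKn : ∀ x k, ‖K x k‖ = (ω k)⁻¹)
    (crit : Crit) : ∃ s : ℝ, 0 < s ∧ CRI ω crit = ENNReal.ofReal s := by
  cases crit with
  | ABS => exact ⟨1, one_pos, by simp [CRI]⟩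
  | NOR =>
    have hle : initErr ω ≤ ENNReal.ofReal ‖K 0‖ := by
      refine iSup_le fun u => iSup_le fun hu => iSup_le fun z => iSup_le fun hz => ?_
      rw [← enorm_eq_nnnorm, ← ofReal_norm, hK]
      refine ENNReal.ofReal_le_ofReal ((norm_inner_le_norm _ _).trans ?_)
      rw [kern_norm ω K hKn z]
      calc _ ≤ ‖K 0‖ * 1 := by gcongr
        _ = _ := mul_one _
    have hne : initErr ω ≠ ⊤ := ne_top_of_le_ne_top ENNReal.ofReal_ne_top hle
    have hK0 : ‖K 0‖ ≠ 0 := by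
      intro h
      have h1 := hKn 0 0
      rw [norm_eq_zero.1 h] at h1
      have := hpos 0
      simp at h1
      linarith
    have h0 : initErr ω ≠ 0 := by
      intro h
      unfold initErr at h
      simp only [ENNReal.iSup_eq_zero] at h
      have := h (((‖K 0‖⁻¹ : ℝ) : ℂ) • K 0) (by
        rw [norm_smul, Complex.norm_real, norm_inv, norm_norm, inv_mul_cancel₀ hK0]) 0 (cube_zero d)
      rw [hK, inner_smul_right, inner_self_eq_norm_sq_to_K] at this
      simp at this
      exact hK0 (by simp [this])
    exact ⟨(initErr ω).toReal, ENNReal.toReal_pos h0 hne, (ENNReal.ofReal_toReal hne).symm⟩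

lemma std_nonempty {d : ℕ} (ω : (Fin d → ℤ) → ℝ) (hpos : ∀ k, 0 < ω k)
    (hsum : Summable fun k => ((ω k) ^ 2)⁻¹) (crit : Crit) (ε : ℝ) (hε : 0 < ε) :
    {n : ℕ | wcErr ω (stdInfo ω) n ≤ ENNReal.ofReal ε * CRI ω crit}.Nonempty := by
  obtain ⟨K, hK, hKn⟩ := exists_kern ω hpos hsum
  obtain ⟨s, hs, hcri⟩ := CRI_pos ω hpos K hK hKn crit
  have : Nonempty (cube d) := ⟨⟨0, cube_zero d⟩⟩
  obtain ⟨n, x, h⟩ := greedy_tendsto (fun x : cube d => K x) ‖K 0‖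
    (fun x => (kern_norm ω K hKn x).le)
    (fun δ hδ => by
      obtain ⟨W, hW, h⟩ := kern_tail ω hsum K hKn δ hδ
      exact ⟨W, hW, fun x => h x⟩) (ε * s) (by positivity)
  refine ⟨n, ?_⟩
  rw [Set.mem_ofPred_eq, hcri, ← ENNReal.ofReal_mul hε.le]
  exact std_le ω K hK n x _ h

lemma infoComp_le {d : ℕ} (ω : (Fin d → ℤ) → ℝ) (hpos : ∀ k, 0 < ω k)
    (hsum : Summable fun k => ((ω k) ^ 2)⁻¹) (crit : Crit) (ε : ℝ) (hε : 0 < ε) :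
    infoComp ω (allInfo d) crit ε ≤ infoComp ω (stdInfo ω) crit ε := by
  obtain ⟨K, hK, hKn⟩ := exists_kern ω hpos hsum
  have h := Nat.sInf_mem (std_nonempty ω hpos hsum crit ε hε)
  exact Nat.sInf_le ((all_le_std ω K hK _).trans h)

lemma rate_transfer
    (ω : (d : ℕ) → (Fin d → ℤ) → ℝ)
    (hpos : ∀ d, 0 < d → ∀ k, 0 < ω d k)
    (hsum : ∀ d, 0 < d → Summable fun k => ((ω d k) ^ 2)⁻¹)
    (crit : Crit) (C p : ℝ) (hC : 0 < C) (hp : 0 < p)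
    (h : ∀ d : ℕ, 0 < d → ∀ ε ∈ Set.Ioo (0:ℝ) 1,
      (infoComp (ω d) (allInfo d) crit ε : ℝ) ≤ C * ε ^ (-p)) :
    ∃ C' > (0:ℝ), ∀ d : ℕ, 0 < d → ∀ ε ∈ Set.Ioo (0:ℝ) 1,
      (infoComp (ω d) (stdInfo (ω d)) crit ε : ℝ) ≤ C' * ε ^ (-p) := by
  obtain ⟨C', hC', hmain⟩ := greedy_rate C p hC hp
  refine ⟨C', hC', fun d hd ε hε => ?_⟩
  obtain ⟨K, hK, hKn⟩ := exists_kern (ω d) (hpos d hd) (hsum d hd)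
  obtain ⟨s, hs, hcri⟩ := CRI_pos (ω d) (hpos d hd) K hK hKn crit
  have : Nonempty (cube d) := ⟨⟨0, cube_zero d⟩⟩
  obtain ⟨n, x, hn, hx⟩ := hmain (Coef d) (cube d) (fun x => K x) ‖K 0‖
    (fun x => (kern_norm (ω d) K hKn x).le) s hs (fun ε hε => by
      have hne : {n : ℕ | wcErr (ω d) (allInfo d) n ≤ ENNReal.ofReal ε * CRI (ω d) crit}.Nonempty :=
        (std_nonempty (ω d) (hpos d hd) (hsum d hd) crit ε hε.1).mono
          fun n hn => (all_le_std (ω d) K hK n).trans hn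
      have hmem : wcErr (ω d) (allInfo d) (infoComp (ω d) (allInfo d) crit ε) ≤
          ENNReal.ofReal ε * CRI (ω d) crit := Nat.sInf_mem hne
      rw [hcri, ← ENNReal.ofReal_mul hε.1.le] at hmem
      have hes : 0 < ε * s := mul_pos hε.1 hs
      obtain ⟨W, hWf, hWr, hWn⟩ := near_of_all (ω d) K hK _ (2 * ε * s) (by linarith)
        (hmem.trans_lt ((ENNReal.ofReal_lt_ofReal_iff (by linarith)).2 (by linarith)))
      refine ⟨W, hWf, le_trans ?_ (h d hd ε hε), hWn⟩
      exact_mod_cast hWr) ε hε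
  refine le_trans ?_ hn
  have : infoComp (ω d) (stdInfo (ω d)) crit ε ≤ n := by
    refine Nat.sInf_le ?_
    rw [Set.mem_ofPred_eq, hcri, ← ENNReal.ofReal_mul hε.1.le]
    exact std_le (ω d) K hK n x _ hx
  exact_mod_cast this

end Bridge

/-- ALG-SPT for `Λ^all` is equivalent to ALG-SPT for `Λ^std`, and in this
case the exponents of ALG-SPT coincide, for the absolute or normalized error criterion. -/
theorem stmt4
    (ω : (d : ℕ) → (Fin d → ℤ) → ℝ)
    (hpos : ∀ d, 0 < d → ∀ k, 0 < ω d k)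
    (hsum : ∀ d, 0 < d → Summable fun k => ((ω d k) ^ 2)⁻¹)
    (crit : Crit) :
    (ALGSPT (fun d ε => infoComp (ω d) (allInfo d) crit ε) ↔
      ALGSPT (fun d ε => infoComp (ω d) (stdInfo (ω d)) crit ε)) ∧
    (ALGSPT (fun d ε => infoComp (ω d) (allInfo d) crit ε) →
      ALGSPTexp (fun d ε => infoComp (ω d) (allInfo d) crit ε) =
        ALGSPTexp (fun d ε => infoComp (ω d) (stdInfo (ω d)) crit ε)) := by
  have hup : ∀ C p p' : ℝ, 0 < C → p < p' →
      (∀ d : ℕ, 0 < d → ∀ ε ∈ Set.Ioo (0:ℝ) 1,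
        (infoComp (ω d) (allInfo d) crit ε : ℝ) ≤ C * ε ^ (-p)) → 0 ≤ p →
      ∃ C' > (0:ℝ), ∀ d : ℕ, 0 < d → ∀ ε ∈ Set.Ioo (0:ℝ) 1,
        (infoComp (ω d) (stdInfo (ω d)) crit ε : ℝ) ≤ C' * ε ^ (-p') := by
    intro C p p' hC hpp h hp
    refine rate_transfer ω hpos hsum crit C p' hC (by linarith) fun d hd ε hε => ?_
    refine (h d hd ε hε).trans ?_
    exact mul_le_mul_of_nonneg_left
      (Real.rpow_le_rpow_of_exponent_ge hε.1 hε.2.le (by linarith)) hC.le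
  have hdown : ∀ C p : ℝ, (∀ d : ℕ, 0 < d → ∀ ε ∈ Set.Ioo (0:ℝ) 1,
        (infoComp (ω d) (stdInfo (ω d)) crit ε : ℝ) ≤ C * ε ^ (-p)) →
      (∀ d : ℕ, 0 < d → ∀ ε ∈ Set.Ioo (0:ℝ) 1,
        (infoComp (ω d) (allInfo d) crit ε : ℝ) ≤ C * ε ^ (-p)) := by
    intro C p h d hd ε hε
    refine le_trans ?_ (h d hd ε hε)
    exact_mod_cast infoComp_le (ω d) (hpos d hd) (hsum d hd) crit ε hε.1
  refine ⟨⟨?_, ?_⟩, ?_⟩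
  · rintro ⟨C, hC, p, hp, h⟩
    obtain ⟨C', hC', h'⟩ := hup C p (p + 1) hC (by linarith) h hp
    exact ⟨C', hC', p + 1, by linarith, h'⟩
  · rintro ⟨C, hC, p, hp, h⟩
    exact ⟨C, hC, p, hp, hdown C p h⟩
  · rintro ⟨C, hC, p, hp, h⟩
    unfold ALGSPTexp
    apply le_antisymm
    · obtain ⟨C', hC', h'⟩ := hup C p (p + 1) hC (by linarith) h hp
      refine csInf_le_csInf ⟨0, fun q hq => hq.1⟩ ⟨p + 1, by linarith, C', hC', h'⟩ ?_
      rintro q ⟨hq, D, hD, hh⟩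
      exact ⟨hq, D, hD, hdown D q hh⟩
    · refine le_csInf ⟨p, hp, C, hC, h⟩ ?_
      rintro q ⟨hq, D, hD, hh⟩
      refine le_of_forall_pos_le_add fun δ hδ => ?_
      obtain ⟨D', hD', hh'⟩ := hup D q (q + δ) hD (by linarith) hh hq
      exact csInf_le ⟨0, fun q hq => hq.1⟩ ⟨by linarith, D', hD', hh'⟩
end
end
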